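/- arXiv:2405.17981 — 7 statements merged into one kernel-verified Lean document; each statement's English description precedes it below -/
import Mathlib

section
/- Let $f>2$ be a rational integer. Then the mean value $M(1,f)=\frac{2}{\phi(f)}\sum_{\chi\bmod f,\ \chi(-1)=-1}\vert L(1,\chi)\vert^2$, where $\chi$ ranges over the $\phi(f)/2$ odd Dirichlet characters modulo $f$, satisfies $M(1,f)=\frac{\pi^2}{6}\left(\phi_2(f)-3\frac{\phi_1(f)}{f}\right)$. -/
open scoped Classical Real

section

open Filter Topology

lemma abs_inv_rpow_sub_inv_rpow_le {m u v s : ℝ} (hm : 0 < m) (hm1 : m ≤ 1) (hu : m ≤ u)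
    (hv : m ≤ v) (hs : 1 ≤ s) (hs2 : s ≤ 2) (w : ℝ) (hw : m ≤ w) (hwu : w ≤ u) (hwv : w ≤ v) :
    |1 / u ^ s - 1 / v ^ s| ≤ 2 / m * (1 / w ^ 2) * |u - v| := by
  have hw0 : 0 < w := hm.trans_le hw
  have key := (convex_Ici w).norm_image_sub_le_of_norm_hasDerivWithin_le
    (f := fun x : ℝ ↦ x ^ (-s)) (f' := fun x ↦ -s * x ^ (-s - 1)) (C := 2 / m * (1 / w ^ 2))
    (x := v) (y := u)
    (fun x hx ↦ (Real.hasDerivAt_rpow_const (.inl (hw0.trans_le hx).ne')).hasDerivWithinAt)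
    (fun x hx ↦ ?_) hwv hwu
  · simpa [Real.rpow_neg (hm.le.trans hu), Real.rpow_neg (hm.le.trans hv)] using key
  · have hx : w ≤ x := hx
    have hx0 : 0 < x := hw0.trans_le hx
    have h1 : x ^ (-s - 1) ≤ 1 / m * (1 / w ^ 2) := by
      calc x ^ (-s - 1) ≤ w ^ (-s - 1) := Real.rpow_le_rpow_of_nonpos hw0 hx (by linarith)
        _ = w ^ (1 - s) * w ^ (-2 : ℝ) := by rw [← Real.rpow_add hw0]; ring_nf
        _ = w ^ (1 - s) * (1 / w ^ 2) := by
          rw [Real.rpow_neg hw0.le, Real.rpow_two, one_div]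
        _ ≤ 1 / m * (1 / w ^ 2) := by
          gcongr
          calc w ^ (1 - s) ≤ m ^ (1 - s) := Real.rpow_le_rpow_of_nonpos hm hw (by linarith)
            _ ≤ m ^ (-1 : ℝ) := Real.rpow_le_rpow_of_exponent_ge hm hm1 (by linarith)
            _ = 1 / m := by rw [Real.rpow_neg_one, one_div]
    have h2 : 0 ≤ x ^ (-s - 1) := by positivity
    rw [norm_mul, norm_neg, Real.norm_of_nonneg (by linarith : 0 ≤ s), Real.norm_of_nonneg h2]
    calc s * x ^ (-s - 1) ≤ 2 * (1 / m * (1 / w ^ 2)) := by gcongr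
      _ = _ := by ring

lemma summable_one_div_nat_add_sq (m : ℝ) :
    Summable fun n : ℕ ↦ 1 / ((n : ℝ) + m) ^ 2 := by
  have := (Real.summable_one_div_nat_add_rpow m 2).mpr (by norm_num)
  simpa using this

lemma abs_one_div_add_rpow_sub_one_div_rpow_le {a s : ℝ} (ha : a ∈ Set.Ioo (0 : ℝ) 1)
    (hs : 1 ≤ s) (hs2 : s ≤ 2) (n : ℕ) :
    |1 / (n + a) ^ s - 1 / (n + 1 - a) ^ s| ≤
      2 / min a (1 - a) * (1 / (n + min a (1 - a)) ^ 2) := by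
  obtain ⟨h0, h1⟩ := ha
  have hn : (0 : ℝ) ≤ n := n.cast_nonneg
  have hm : 0 < min a (1 - a) := lt_min h0 (by linarith)
  have hma := min_le_left a (1 - a)
  have hmb := min_le_right a (1 - a)
  refine (abs_inv_rpow_sub_inv_rpow_le hm (by linarith) (u := n + a) (v := n + 1 - a)
    (by linarith) (by linarith) hs hs2 (n + min a (1 - a)) (by linarith) (by linarith)
    (by linarith)).trans ?_
  refine mul_le_of_le_one_right (by positivity) ?_
  rw [abs_le]; constructor <;> linarith

lemma hasSum_pi_mul_cot {a : ℝ} (ha : a ∈ Set.Ioo (0 : ℝ) 1) :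
    HasSum (fun n : ℕ ↦ 1 / (n + a) - 1 / (n + 1 - a)) (π * Real.cot (π * a)) := by
  have hsum : Summable (fun n : ℕ ↦ 1 / (n + a) - 1 / (n + 1 - a)) := by
    refine Summable.of_norm_bounded ((summable_one_div_nat_add_sq (min a (1 - a))).mul_left
      (2 / min a (1 - a))) fun n ↦ ?_
    simpa using abs_one_div_add_rpow_sub_one_div_rpow_le ha le_rfl one_le_two n
  rw [hsum.hasSum_iff_tendsto_nat]
  have haZ : (a : ℂ) ∈ Complex.integerComplement := by
    rintro ⟨k, hk⟩
    have hk : (k : ℝ) = a := by exact_mod_cast hk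
    have h1 : (0 : ℝ) < k := hk ▸ ha.1
    have h2 : (k : ℝ) < 1 := hk ▸ ha.2
    norm_cast at h1 h2
    lia
  have h1 := tendsto_logDeriv_euler_cot_sub haZ
  have h2 : Tendsto (fun N : ℕ ↦ ∑ n ∈ Finset.range N, (1 / (a - (n + 1)) + 1 / (a + (n + 1))))
      atTop (𝓝 (π * Real.cot (π * a) - 1 / a)) := by
    rw [← tendsto_ofReal_iff]
    push_cast
    exact h1
  have h3 : Tendsto (fun N : ℕ ↦ (1 : ℝ) / (a - (N + 1))) atTop (𝓝 0) := by
    have : Tendsto (fun N : ℕ ↦ (N : ℝ) + (1 - a)) atTop atTop :=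
      tendsto_atTop_add_const_right _ _ tendsto_natCast_atTop_atTop
    refine (neg_zero (G := ℝ) ▸ this.inv_tendsto_atTop.neg).congr fun N ↦ ?_
    rw [Pi.inv_apply, ← inv_neg, one_div]
    ring_nf
  rw [← tendsto_add_atTop_iff_nat 1]
  have h4 := (h2.add h3).add_const (1 / a)
  rw [show π * Real.cot (π * a) - 1 / a + 0 + 1 / a = π * Real.cot (π * a) by ring] at h4
  refine h4.congr fun N ↦ ?_
  have hne (n : ℕ) : a - (n + 1) ≠ 0 := by
    have : (0 : ℝ) ≤ n := n.cast_nonneg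
    have := ha.2
    linarith
  have hflip (n : ℕ) : 1 / (n + 1 - a) = -(1 / (a - (n + 1))) := by
    rw [← neg_sub, one_div_neg_eq_neg_one_div]
  induction N with
  | zero =>
    simp only [zero_add, Finset.sum_range_zero, Finset.sum_range_one, hflip]
    push_cast
    ring_nf
  | succ N ih =>
    rw [Finset.sum_range_succ _ (N + 1), ← ih, Finset.sum_range_succ]
    simp only [hflip]; push_cast; ring

lemma hasSum_pi_sq_mul_one_add_cot_sq {a : ℝ} (ha : a ∈ Set.Ioo (0 : ℝ) 1) :
    HasSum (fun n : ℕ ↦ 1 / (n + a) ^ 2 + 1 / (n + 1 - a) ^ 2)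
      (π ^ 2 * (1 + Real.cot (π * a) ^ 2)) := by
  obtain ⟨h0, h1⟩ := ha
  have hs : Summable fun n : ℕ ↦ 1 / (n + a) ^ 2 + 1 / (n + 1 - a) ^ 2 := by
    simpa only [add_sub_assoc] using
      (summable_one_div_nat_add_sq a).add (summable_one_div_nat_add_sq (1 - a))
  set t := Set.Ioo (a / 2) ((1 + a) / 2) with ht
  have hat : a ∈ t := ⟨by linarith, by linarith⟩
  have ht01 {y : ℝ} (hy : y ∈ t) : y ∈ Set.Ioo (0 : ℝ) 1 :=
    ⟨by linarith [hy.1], by linarith [hy.2]⟩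
  have hder := hasDerivAt_tsum_of_isPreconnected (t := t) (y₀ := a) (y := a)
    (g := fun (n : ℕ) (x : ℝ) ↦ 1 / (n + x) - 1 / (n + 1 - x))
    (g' := fun (n : ℕ) (x : ℝ) ↦ -(1 / (n + x) ^ 2 + 1 / (n + 1 - x) ^ 2))
    (((summable_one_div_nat_add_sq (a / 2)).add (summable_one_div_nat_add_sq ((1 - a) / 2))))
    isOpen_Ioo isPreconnected_Ioo (fun n y hy ↦ ?_) (fun n y hy ↦ ?_) hat
    (hasSum_pi_mul_cot ⟨h0, h1⟩).summable hat
  · have hsin : Real.sin (π * a) ≠ 0 :=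
      (Real.sin_pos_of_pos_of_lt_pi (by positivity) (by nlinarith [Real.pi_pos])).ne'
    have hcot : HasDerivAt (fun x ↦ π * Real.cot (π * x))
        (-(π ^ 2 * (1 + Real.cot (π * a) ^ 2))) a := by
      simp only [Real.cot_eq_cos_div_sin]
      have hlin : HasDerivAt (fun x : ℝ ↦ π * x) π a := by
        simpa using (hasDerivAt_id a).const_mul π
      convert! ((hlin.cos.div hlin.sin hsin).const_mul π) using 1
      field_simp
      ring
    have heq : (fun x : ℝ ↦ ∑' n : ℕ, (1 / (n + x) - 1 / (n + 1 - x))) =ᶠ[𝓝 a]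
        fun x ↦ π * Real.cot (π * x) := by
      filter_upwards [isOpen_Ioo.mem_nhds hat] with x hx using (hasSum_pi_mul_cot (ht01 hx)).tsum_eq
    have := (hder.congr_of_eventuallyEq heq.symm).unique hcot
    rw [tsum_neg, neg_inj] at this
    exact this ▸ hs.hasSum
  · obtain ⟨hy0, hy1⟩ := ht01 hy
    have hn : (0 : ℝ) ≤ n := n.cast_nonneg
    have d1 := ((hasDerivAt_id y).const_add (n : ℝ)).inv (by simp only [id]; linarith)
    have d2 := ((hasDerivAt_id y).const_sub ((n : ℝ) + 1)).inv (by simp only [id]; linarith)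
    convert! d1.sub d2 using 1
    · ext x; simp
    · simp only [id]; ring
  · obtain ⟨hy0, hy1⟩ := ht01 hy
    have hn : (0 : ℝ) ≤ n := n.cast_nonneg
    have hy2 := hy.1
    have hy3 := hy.2
    have hp : 0 < n + 1 - y := by linarith
    rw [norm_neg, Real.norm_of_nonneg (by positivity)]
    gcongr
    linarith

lemma hurwitzZetaOdd_one_eq {a : ℝ} (ha : a ∈ Set.Ioo (0 : ℝ) 1) :
    HurwitzZeta.hurwitzZetaOdd a 1 = ((π * Real.cot (π * a) / 2 : ℝ) : ℂ) := by
  have h0 := ha.1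
  have h1 := ha.2
  have hlim : Tendsto (fun x : ℝ ↦ HurwitzZeta.hurwitzZetaOdd a x) (𝓝[>] 1)
      (𝓝 (HurwitzZeta.hurwitzZetaOdd a 1)) := by
    have : Continuous fun x : ℝ ↦ HurwitzZeta.hurwitzZetaOdd a x :=
      (HurwitzZeta.differentiable_hurwitzZetaOdd a).continuous.comp Complex.continuous_ofReal
    simpa using (this.tendsto 1).mono_left nhdsWithin_le_nhds
  refine tendsto_nhds_unique hlim ?_
  have hser : ∀ᶠ x : ℝ in 𝓝[>] 1,
      ((∑' n : ℕ, (1 / (n + a) ^ x - 1 / (n + 1 - a) ^ x) / 2 : ℝ) : ℂ) =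
        HurwitzZeta.hurwitzZetaOdd a x := by
    filter_upwards [self_mem_nhdsWithin] with x hx
    rw [← (HurwitzZeta.hasSum_nat_hurwitzZetaOdd_of_mem_Icc (Set.Ioo_subset_Icc_self ha)
      (by simpa using hx)).tsum_eq, Complex.ofReal_tsum]
    refine tsum_congr fun n ↦ ?_
    have hn : (0 : ℝ) ≤ n := n.cast_nonneg
    push_cast [Complex.ofReal_cpow (by linarith : (0 : ℝ) ≤ n + a),
      Complex.ofReal_cpow (by linarith : (0 : ℝ) ≤ n + 1 - a)]
    rfl
  refine Tendsto.congr' hser ((Complex.continuous_ofReal.tendsto _).comp ?_)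
  rw [← ((hasSum_pi_mul_cot ha).div_const 2).tsum_eq]
  refine tendsto_tsum_of_dominated_convergence (((summable_one_div_nat_add_sq
    (min a (1 - a))).mul_left (2 / min a (1 - a))).div_const 2) (fun n ↦ ?_) ?_
  · have hn : (0 : ℝ) ≤ n := n.cast_nonneg
    have hc : ContinuousAt (fun x : ℝ ↦ (1 / (n + a) ^ x - 1 / (n + 1 - a) ^ x) / 2) 1 := by
      have e1 : 0 < n + a := by linarith
      have e2 : 0 < n + 1 - a := by linarith
      have e3 := (Real.rpow_pos_of_pos e1 1).ne'
      have e4 := (Real.rpow_pos_of_pos e2 1).ne'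
      have e5 := Real.continuousAt_const_rpow (b := 1) e1.ne'
      have e6 := Real.continuousAt_const_rpow (b := 1) e2.ne'
      exact ((continuousAt_const.div e5 e3).sub (continuousAt_const.div e6 e4)).div_const 2
    simpa using hc.tendsto.mono_left nhdsWithin_le_nhds
  · filter_upwards [Ioc_mem_nhdsGT (one_lt_two (α := ℝ))] with x hx n
    rw [norm_div, Real.norm_two]
    have := abs_one_div_add_rpow_sub_one_div_rpow_le ha hx.1.le hx.2 n
    rw [Real.norm_eq_abs]
    gcongr

lemma hurwitzZetaEven_two_eq {a : ℝ} (ha : a ∈ Set.Ioo (0 : ℝ) 1) :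
    HurwitzZeta.hurwitzZetaEven a 2 = ((π ^ 2 * (1 + Real.cot (π * a) ^ 2) / 2 : ℝ) : ℂ) := by
  rw [← ((hasSum_pi_sq_mul_one_add_cot_sq ha).div_const 2).tsum_eq, Complex.ofReal_tsum,
    ← (HurwitzZeta.hasSum_nat_hurwitzZetaEven_of_mem_Icc (Set.Ioo_subset_Icc_self ha)
      (by simp)).tsum_eq]
  refine tsum_congr fun n ↦ ?_
  norm_num [← Complex.ofReal_natCast]

end

lemma sum_norm_sq_sum_dirichletCharacter_mul {f : ℕ} [NeZero f] (g : ZMod f → ℂ) :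
    ∑ χ : DirichletCharacter ℂ f, ‖∑ j, χ j * g j‖ ^ 2 =
      f.totient * ∑ j with IsUnit j, ‖g j‖ ^ 2 := by
  suffices h : ∑ χ : DirichletCharacter ℂ f, ((‖∑ j, χ j * g j‖ ^ 2 : ℝ) : ℂ) =
      f.totient * ∑ j with IsUnit j, ((‖g j‖ ^ 2 : ℝ) : ℂ) by exact_mod_cast h
  have hrestrict (χ : DirichletCharacter ℂ f) :
      ∑ j, χ j * g j = ∑ j with IsUnit j, χ j * g j := by
    refine (Finset.sum_filter_of_ne fun j _ hj ↦ ?_).symm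
    contrapose! hj
    rw [χ.map_nonunit hj, zero_mul]
  have hstar (χ : DirichletCharacter ℂ f) {j : ZMod f} (hj : IsUnit j) :
      (starRingEnd ℂ) (χ j) = χ j⁻¹ := by
    obtain ⟨u, rfl⟩ := hj
    rw [← RCLike.star_def, MulChar.star_apply', MulChar.inv_apply, Ring.inverse_unit,
      ZMod.inv_coe_unit]
  calc _ = ∑ χ : DirichletCharacter ℂ f, ∑ a with IsUnit a, ∑ b with IsUnit b,
        (χ a⁻¹ * χ b) * ((starRingEnd ℂ) (g a) * g b) := by
        refine Finset.sum_congr rfl fun χ _ ↦ ?_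
        rw [hrestrict, Complex.ofReal_pow, ← Complex.conj_mul', map_sum, Finset.sum_mul_sum]
        refine Finset.sum_congr rfl fun a ha ↦ Finset.sum_congr rfl fun b _ ↦ ?_
        rw [map_mul, hstar χ (Finset.mem_filter.mp ha).2]
        ring
    _ = ∑ a with IsUnit a, ∑ b with IsUnit b,
        (if a = b then (f.totient : ℂ) else 0) * ((starRingEnd ℂ) (g a) * g b) := by
        rw [Finset.sum_comm]
        refine Finset.sum_congr rfl fun a ha ↦ ?_
        rw [Finset.sum_comm]
        refine Finset.sum_congr rfl fun b _ ↦ ?_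
        rw [← Finset.sum_mul, DirichletCharacter.sum_char_inv_mul_char_eq ℂ
          (Finset.mem_filter.mp ha).2]
    _ = _ := by
        rw [Finset.mul_sum]
        refine Finset.sum_congr rfl fun a ha ↦ ?_
        simp only [ite_mul, zero_mul, Finset.sum_ite_eq, ha, if_true]
        rw [Complex.conj_mul', Complex.ofReal_pow]

lemma sum_hurwitzZetaEven_two {f : ℕ} [NeZero f] :
    ∑ j : ZMod f with IsUnit j, HurwitzZeta.hurwitzZetaEven (ZMod.toAddCircle j) 2 =
      ((f ^ 2 * ((∏ p ∈ f.primeFactors, (1 - 1 / (p : ℝ) ^ 2)) * (π ^ 2 / 6)) : ℝ) : ℂ) := by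
  have hf : (f : ℂ) ≠ 0 := NeZero.ne _
  have h1 := DirichletCharacter.LFunctionTrivChar_eq_mul_riemannZeta (N := f) (s := 2) (by norm_num)
  rw [riemannZeta_two, DirichletCharacter.LFunctionTrivChar, DirichletCharacter.LFunction,
    ZMod.LFunction_def_even (DirichletCharacter.Even.to_fun
      (MulChar.one_apply isUnit_one.neg))] at h1
  have h2 : ∑ j : ZMod f, (1 : DirichletCharacter ℂ f) j *
      HurwitzZeta.hurwitzZetaEven (ZMod.toAddCircle j) 2 =
      ∑ j : ZMod f with IsUnit j, HurwitzZeta.hurwitzZetaEven (ZMod.toAddCircle j) 2 := by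
    rw [Finset.sum_filter]
    refine Finset.sum_congr rfl fun j _ ↦ ?_
    split_ifs with hj
    · rw [MulChar.one_apply hj, one_mul]
    · rw [MulChar.map_nonunit _ hj, zero_mul]
  rw [h2] at h1
  have h3 (x : ℂ) : x ^ (-2 : ℂ) = 1 / x ^ 2 := by
    rw [Complex.cpow_neg, one_div]; norm_cast
  simp only [h3] at h1
  push_cast
  rw [← h1]
  field_simp

lemma norm_hurwitzZetaOdd_one_sq {f : ℕ} [NeZero f] {j : ZMod f} (hj : j ≠ 0) :
    ((‖HurwitzZeta.hurwitzZetaOdd (ZMod.toAddCircle j) 1‖ ^ 2 : ℝ) : ℂ) =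
      HurwitzZeta.hurwitzZetaEven (ZMod.toAddCircle j) 2 / 2 - π ^ 2 / 4 := by
  have hf : (0 : ℝ) < f := Nat.cast_pos.mpr (NeZero.pos f)
  have ha : (j.val / f : ℝ) ∈ Set.Ioo (0 : ℝ) 1 := by
    refine ⟨div_pos (Nat.cast_pos.mpr (ZMod.val_pos.mpr hj)) hf, ?_⟩
    rw [div_lt_one hf]
    exact_mod_cast j.val_lt
  rw [ZMod.toAddCircle_apply, hurwitzZetaOdd_one_eq ha, hurwitzZetaEven_two_eq ha,
    Complex.norm_real, Real.norm_eq_abs, sq_abs]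
  push_cast
  ring

lemma sum_norm_sq_LFunction_one_odd {f : ℕ} [NeZero f] :
    ∑ χ : DirichletCharacter ℂ f with χ (-1) = -1, ‖χ.LFunction 1‖ ^ 2 =
      f.totient / f ^ 2 *
        ∑ j : ZMod f with IsUnit j, ‖HurwitzZeta.hurwitzZetaOdd (ZMod.toAddCircle j) 1‖ ^ 2 := by
  have hodd : (fun j : ZMod f ↦ HurwitzZeta.hurwitzZetaOdd (ZMod.toAddCircle j) 1).Odd :=
    fun j ↦ by simp only [map_neg, HurwitzZeta.hurwitzZetaOdd_neg]
  rw [div_mul_eq_mul_div, ← sum_norm_sq_sum_dirichletCharacter_mul, Finset.sum_div,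
    Finset.sum_filter]
  refine Finset.sum_congr rfl fun χ _ ↦ ?_
  split_ifs with hχ
  · rw [DirichletCharacter.LFunction, ZMod.LFunction_def_odd (DirichletCharacter.Odd.to_fun hχ),
      norm_mul, mul_pow, Complex.cpow_neg_one, norm_inv, Complex.norm_natCast]
    ring
  · have hev : χ.Even := χ.even_or_odd.resolve_right hχ
    have : (fun j : ZMod f ↦
        χ j * HurwitzZeta.hurwitzZetaOdd (ZMod.toAddCircle j) 1).Odd :=
      hev.to_fun.mul_odd hodd
    rw [this.sum_eq_zero]
    simp

/-- **Mean value of `|L(1,χ)|²` over odd Dirichlet characters mod `f`.**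
For `f > 2`,
`M(1,f) = (2/φ(f)) ∑_{χ(-1)=-1} |L(1,χ)|² = (π²/6) (φ₂(f) - 3 φ₁(f)/f)`,
where `φ_l(f) = ∏_{p ∣ f} (1 - 1/p^l)`. -/
theorem mean_value_L_one_sq (f : ℕ) [NeZero f] (hf : 2 < f) :
    (2 / (Nat.totient f : ℝ)) *
      ∑ χ ∈ Finset.univ.filter (fun χ : DirichletCharacter ℂ f => χ (-1) = -1),
        ‖χ.LFunction 1‖ ^ 2
    = (π ^ 2 / 6) *
        ((∏ p ∈ f.primeFactors, (1 - 1 / (p : ℝ) ^ 2))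
          - 3 * (∏ p ∈ f.primeFactors, (1 - 1 / (p : ℝ))) / f) := by
  have hf0 : (f : ℝ) ≠ 0 := NeZero.ne _
  have hφ : (f.totient : ℝ) ≠ 0 := by
    exact_mod_cast (Nat.totient_pos.mpr (NeZero.pos f)).ne'
  have hφ1 : (f.totient : ℝ) = f * ∏ p ∈ f.primeFactors, (1 - 1 / (p : ℝ)) := by
    have := congrArg (Rat.cast (K := ℝ)) (Nat.totient_eq_mul_prod_factors f)
    push_cast at this
    simpa only [one_div] using this
  have hcard : (({j : ZMod f | IsUnit j} : Finset (ZMod f)).card : ℝ) = f.totient := by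
    rw [← ZMod.card_units_eq_totient]
    norm_cast
    rw [← Finset.card_univ, ← Finset.card_map ⟨Units.val, Units.val_injective⟩]
    congr 1
    ext j
    rw [Finset.mem_filter_univ]
    simp [IsUnit]
  have hmain : ∑ j : ZMod f with IsUnit j,
      ‖HurwitzZeta.hurwitzZetaOdd (ZMod.toAddCircle j) 1‖ ^ 2 =
      f ^ 2 * ((∏ p ∈ f.primeFactors, (1 - 1 / (p : ℝ) ^ 2)) * (π ^ 2 / 6)) / 2 -
        f.totient * (π ^ 2 / 4) := by
    rw [← hcard, ← Complex.ofReal_inj, Complex.ofReal_sum, Complex.ofReal_sub, Complex.ofReal_div,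
      ← sum_hurwitzZetaEven_two, Finset.sum_div]
    have : Fact (1 < f) := ⟨by lia⟩
    rw [Finset.sum_congr rfl fun j hj ↦
      norm_hurwitzZetaOdd_one_sq (Finset.mem_filter.mp hj).2.ne_zero, Finset.sum_sub_distrib]
    simp
  rw [sum_norm_sq_LFunction_one_odd, hmain]
  rw [show (2 / (f.totient : ℝ)) * (f.totient / f ^ 2 * (f ^ 2 *
    ((∏ p ∈ f.primeFactors, (1 - 1 / (p : ℝ) ^ 2)) * (π ^ 2 / 6)) / 2 -
        f.totient * (π ^ 2 / 4))) = (π ^ 2 / 6) *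
        ((∏ p ∈ f.primeFactors, (1 - 1 / (p : ℝ) ^ 2)) - 3 * (f.totient / f) / f) by
    field_simp; ring, hφ1, mul_div_cancel_left₀ _ hf0]
end

section
/- Let $m\ge 2$ and $f>2$ be rational integers. Then the mean value $M(m,f)=\frac{2}{\phi(f)}\sum_{\chi\bmod f,\ \chi(-1)=(-1)^m}\vert L(m,\chi)\vert^2$, where $\chi$ ranges over the $\phi(f)/2$ Dirichlet characters modulo $f$ with $\chi(-1)=(-1)^m$, satisfies $$M(m,f)=\zeta(2m)\left(\phi_{2m}(f)+(-1)^{m-1}\binom{2m}{m}\sum_{k=1}^{\lfloor m/2\rfloor}\frac{m}{m-k}\binom{m}{2k}\frac{B_{2k}B_{2(m-k)}}{B_{2m}}\frac{\phi_{2k}(f)}{f^{2m-2k}}\right).$$ -/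
open scoped Classical Real

/-- A sum over `{0, …, m}` whose odd-indexed terms vanish from index `3` on. -/
theorem sum_range_succ_eq_sum_even_add_one {M : Type*} [AddCommMonoid M] {m : ℕ} (hm : 1 ≤ m)
    (F : ℕ → M) (hF : ∀ i, Odd i → 1 < i → F i = 0) :
    ∑ i ∈ Finset.range (m + 1), F i = ∑ k ∈ Finset.range (m / 2 + 1), F (2 * k) + F 1 := by
  rw [← Finset.sum_filter_add_sum_filter_not (Finset.range (m + 1)) Even]
  congr 1
  · refine (Finset.sum_nbij (2 * ·) ?_ ?_ ?_ fun _ _ ↦ rfl).symm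
    · intro k hk
      simp only [Finset.mem_range, Finset.mem_filter] at hk ⊢
      exact ⟨by omega, even_two_mul k⟩
    · intro a _ b _ h
      simpa using h
    · intro i hi
      simp only [Finset.coe_filter, Finset.mem_range, Set.mem_ofPred_eq] at hi
      obtain ⟨k, hk⟩ := hi.2
      exact ⟨k, by simp; omega, by simp; omega⟩
  · refine Finset.sum_eq_single_of_mem 1 (by simp; omega) fun i hi h1 ↦ ?_
    simp only [Finset.mem_filter, Nat.not_even_iff_odd] at hi
    exact hF i hi.2 (by have := hi.2.pos; omega)

/-- The forward difference of `B_m(x)²`. -/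
theorem bernoulli_eval_one_add_sq (m : ℕ) (hm : 1 ≤ m) (x : ℚ) :
    ((Polynomial.bernoulli m).eval (1 + x)) ^ 2 = ((Polynomial.bernoulli m).eval x) ^ 2 +
      ∑ k ∈ Finset.range (m / 2 + 1), 2 * m * (m.choose (2 * k)) * bernoulli (2 * k) *
        x ^ (2 * m - 2 * k - 1) := by
  have h : x ^ (m - 1) * (Polynomial.bernoulli m).eval x =
      ∑ k ∈ Finset.range (m / 2 + 1), (m.choose (2 * k)) * bernoulli (2 * k) *
        x ^ (2 * m - 2 * k - 1) - m / 2 * x ^ (2 * m - 2) := by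
    rw [Polynomial.bernoulli, Polynomial.eval_finsetSum, sum_range_succ_eq_sum_even_add_one hm,
      mul_add, Finset.mul_sum, sub_eq_add_neg]
    · congr 1
      · refine Finset.sum_congr rfl fun k hk ↦ ?_
        have hk' : 2 * k ≤ m := by simp at hk; omega
        rw [Polynomial.eval_monomial, show 2 * m - 2 * k - 1 = (m - 1) + (m - 2 * k) by omega,
          pow_add]
        ring
      · rw [Polynomial.eval_monomial, bernoulli_one, Nat.choose_one_right,
          show 2 * m - 2 = (m - 1) + (m - 1) by omega, pow_add]
        ring
    · intro i hi h1
      rw [bernoulli_eq_zero_of_odd hi h1]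
      simp
  have e : 2 * m - 2 = (m - 1) + (m - 1) := by omega
  rw [Polynomial.bernoulli_eval_one_add]
  simp only [mul_assoc (2 * (m : ℚ)), ← Finset.mul_sum]
  rw [sub_eq_iff_eq_add.1 h.symm, e, pow_add]
  ring

/-- Expansion of `B_m(x)²` in Bernoulli polynomials, up to its constant term. -/
theorem exists_bernoulli_sq_eq (m : ℕ) (hm : 1 ≤ m) : ∃ c : ℚ,
    (Polynomial.bernoulli m) ^ 2 = Polynomial.C c + ∑ k ∈ Finset.range (m / 2 + 1),
      Polynomial.C ((m : ℚ) / ((m - k : ℕ) : ℚ) * (m.choose (2 * k)) * bernoulli (2 * k)) *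
        Polynomial.bernoulli (2 * (m - k)) := by
  set D : Polynomial ℚ := (Polynomial.bernoulli m) ^ 2 - ∑ k ∈ Finset.range (m / 2 + 1),
      Polynomial.C ((m : ℚ) / ((m - k : ℕ) : ℚ) * (m.choose (2 * k)) * bernoulli (2 * k)) *
        Polynomial.bernoulli (2 * (m - k)) with hD
  have hstep : ∀ x : ℚ, D.eval (1 + x) = D.eval x := by
    intro x
    simp only [hD, Polynomial.eval_sub, Polynomial.eval_pow, Polynomial.eval_finsetSum,
      Polynomial.eval_mul, Polynomial.eval_C]
    rw [bernoulli_eval_one_add_sq m hm]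
    simp only [Polynomial.bernoulli_eval_one_add, mul_add, Finset.sum_add_distrib]
    have : ∀ a b c d : ℚ, b = d → a + b - (c + d) = a - c := by intros; subst_vars; ring
    refine this _ _ _ _ (Finset.sum_congr rfl fun k hk ↦ ?_)
    have hk' : k < m := by simp at hk; omega
    have h0 : ((m - k : ℕ) : ℚ) ≠ 0 := by
      rw [Nat.cast_ne_zero]; omega
    rw [show 2 * m - 2 * k - 1 = 2 * (m - k) - 1 by omega]
    push_cast
    field_simp
  have hnat : ∀ n : ℕ, D.eval (n : ℚ) = D.eval 0 := by
    intro n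
    induction n with
    | zero => simp
    | succ n ih => rw [← ih, ← hstep n]; push_cast; ring_nf
  refine ⟨D.eval 0, ?_⟩
  have : D = Polynomial.C (D.eval 0) := by
    refine Polynomial.eq_of_infinite_eval_eq _ _ (Set.Infinite.mono (s := Set.range ((↑) : ℕ → ℚ)) ?_
      (Set.infinite_range_of_injective Nat.cast_injective))
    rintro _ ⟨n, rfl⟩
    simp [hnat]
  rw [← this, hD]
  ring

/-- The integral over `[0, 1]` of a product of two nonconstant Bernoulli polynomials. -/
theorem integral_bernoulliFun_mul (a b : ℕ) (hb : 1 ≤ b) :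
    ∫ x : ℝ in 0..1, bernoulliFun (a + 1) x * bernoulliFun b x =
      (-1) ^ a * ((a + 1).factorial * b.factorial / (a + 1 + b).factorial) *
        bernoulli (a + 1 + b) := by
  have key : ∀ c d : ℕ, (c + 1 : ℝ) * ∫ x : ℝ in 0..1, bernoulliFun c x * bernoulliFun (d + 1) x =
      (bernoulliFun (c + 1) 1 * bernoulliFun (d + 1) 1
        - bernoulliFun (c + 1) 0 * bernoulliFun (d + 1) 0) -
      (d + 1 : ℝ) * ∫ x : ℝ in 0..1, bernoulliFun (c + 1) x * bernoulliFun d x := by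
    intro c d
    have h := intervalIntegral.integral_deriv_mul_eq_sub_of_hasDerivAt (a := 0) (b := 1)
      (continuous_bernoulliFun (c + 1)).continuousOn (continuous_bernoulliFun (d + 1)).continuousOn
      (fun x _ ↦ hasDerivAt_bernoulliFun (c + 1) x) (fun x _ ↦ hasDerivAt_bernoulliFun (d + 1) x)
      (Continuous.intervalIntegrable (by fun_prop) _ _)
      (Continuous.intervalIntegrable (by fun_prop) _ _)
    rw [← h, intervalIntegral.integral_add (Continuous.intervalIntegrable (by fun_prop) _ _)
      (Continuous.intervalIntegrable (by fun_prop) _ _)]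
    simp only [mul_assoc, mul_left_comm _ ((d + 1 : ℕ) : ℝ), intervalIntegral.integral_const_mul]
    push_cast
    simp
  induction a generalizing b with
  | zero =>
    have h := key 0 b
    rw [bernoulliFun_endpoints_eq_of_ne_one (k := b + 1) (by omega), bernoulliFun_eval_zero (b + 1)]
      at h
    simp only [bernoulliFun_zero, one_mul, integral_bernoulliFun_eq_zero (Nat.succ_ne_zero b),
      zero_add, bernoulliFun_one] at h ⊢
    generalize ∫ x : ℝ in 0..1, (x - 1 / 2) * bernoulliFun b x = I at h ⊢
    have hb0 := b.factorial_ne_zero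
    rw [add_comm 1 b, Nat.factorial_succ b, Nat.factorial_one]
    push_cast at h ⊢
    field_simp
    linarith
  | succ a ih =>
    have h := key (a + 1) b
    rw [bernoulliFun_endpoints_eq_of_ne_one (k := b + 1) (by omega),
      bernoulliFun_endpoints_eq_of_ne_one (k := a + 1 + 1) (by omega), sub_self, zero_sub,
      ih (b + 1) (by omega), show a + 1 + (b + 1) = a + 1 + 1 + b by omega,
      Nat.factorial_succ b] at h
    rw [← mul_right_inj' (by positivity : (b + 1 : ℝ) ≠ 0), Nat.factorial_succ (a + 1)]
    push_cast at h ⊢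
    linear_combination h

/-- Expansion of `B_m(x)²` in Bernoulli polynomials. -/
theorem bernoulliFun_sq (m : ℕ) (hm : 1 ≤ m) (x : ℝ) :
    bernoulliFun m x ^ 2 =
      (-1) ^ (m - 1) * ((m.factorial : ℝ) ^ 2 / (2 * m).factorial) * bernoulli (2 * m) +
      ∑ k ∈ Finset.range (m / 2 + 1), (m : ℝ) / ((m - k : ℕ) : ℝ) * (m.choose (2 * k)) *
        bernoulli (2 * k) * bernoulliFun (2 * (m - k)) x := by
  obtain ⟨c, hc⟩ := exists_bernoulli_sq_eq m hm
  have h : ∀ x : ℝ, bernoulliFun m x ^ 2 = c +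
      ∑ k ∈ Finset.range (m / 2 + 1), (m : ℝ) / ((m - k : ℕ) : ℝ) * (m.choose (2 * k)) *
        bernoulli (2 * k) * bernoulliFun (2 * (m - k)) x := by
    intro x
    have := congrArg (fun p ↦ (Polynomial.map (algebraMap ℚ ℝ) p).eval x) hc
    simpa [bernoulliFun, Polynomial.eval_finsetSum, Polynomial.map_sum] using this
  have hi : ∫ x : ℝ in 0..1, bernoulliFun m x ^ 2 = c := by
    simp only [h]
    rw [intervalIntegral.integral_add (Continuous.intervalIntegrable (by fun_prop) _ _)
      (Continuous.intervalIntegrable (by fun_prop) _ _), intervalIntegral.integral_finsetSum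
        fun _ _ ↦ Continuous.intervalIntegrable (by fun_prop) _ _]
    simp only [intervalIntegral.integral_const_mul]
    rw [Finset.sum_eq_zero]
    · simp
    · intro k hk
      have : k < m := by simp at hk; omega
      rw [integral_bernoulliFun_eq_zero (by omega), mul_zero]
  rw [h x, ← hi]
  obtain ⟨a, rfl⟩ := Nat.exists_eq_add_of_le' hm
  have := integral_bernoulliFun_mul a (a + 1) hm
  simp only [← sq, ← two_mul] at this
  simp [this]

open ArithmeticFunction in
theorem sum_range_coprime_eq_sum_moebius {f : ℕ} (hf : f ≠ 0) (h : ℕ → ℝ) :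
    ∑ j ∈ Finset.range f with j.Coprime f, h j =
      ∑ d ∈ f.divisors, (moebius d : ℝ) * ∑ b ∈ Finset.range (f / d), h (d * b) := by
  have hind : ∀ j, (if j.Coprime f then h j else 0) =
      ∑ d ∈ f.divisors, if d ∣ j then (moebius d : ℝ) * h j else 0 := by
    intro j
    have h1 := congrArg (fun F : ArithmeticFunction ℝ ↦ F (j.gcd f))
      (coe_moebius_mul_coe_zeta (R := ℝ))
    simp only [coe_mul_zeta_apply, one_apply, intCoe_apply] at h1
    have h2 : (j.gcd f).divisors = f.divisors.filter (· ∣ j) := by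
      ext d
      simp [Nat.dvd_gcd_iff, hf]
      tauto
    rw [← Finset.sum_filter, ← h2, ← Finset.sum_mul, h1]
    simp [Nat.Coprime]
  rw [Finset.sum_filter, Finset.sum_congr rfl fun j _ ↦ hind j, Finset.sum_comm]
  refine Finset.sum_congr rfl fun d hd ↦ ?_
  have hd' := Nat.dvd_of_mem_divisors hd
  have hd0 : 0 < d := Nat.pos_of_mem_divisors hd
  rw [Finset.mul_sum, ← Finset.sum_filter]
  symm
  refine Finset.sum_nbij (d * ·) ?_ ?_ ?_ fun _ _ ↦ rfl
  · intro b hb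
    simp only [Finset.mem_range, Finset.mem_filter] at hb ⊢
    exact ⟨(Nat.lt_div_iff_mul_lt' hd' b).1 hb, dvd_mul_right d b⟩
  · intro a _ b _ hab
    exact Nat.eq_of_mul_eq_mul_left hd0 hab
  · intro j hj
    simp only [Finset.coe_filter, Finset.mem_range, Set.mem_ofPred_eq] at hj
    obtain ⟨hj, b, rfl⟩ := hj
    exact ⟨b, by simpa using (Nat.lt_div_iff_mul_lt' hd' b).2 hj, rfl⟩

open ArithmeticFunction in
theorem sum_moebius_div_pow {n : ℕ} (hn : n ≠ 0) (l : ℕ) :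
    ∑ d ∈ n.divisors, (moebius d : ℝ) / (d : ℝ) ^ l =
      ∏ p ∈ n.primeFactors, (1 - 1 / (p : ℝ) ^ l) := by
  set r := ∏ p ∈ n.primeFactors, p with hr
  have hprime : ∀ p ∈ n.primeFactors, p.Prime := fun p hp ↦ Nat.prime_of_mem_primeFactors hp
  have hrn : r ∣ n := Nat.prod_primeFactors_dvd n
  have hrf : r.primeFactors = n.primeFactors := Nat.primeFactors_prod hprime
  have hrs : Squarefree r := by
    rw [hr]
    exact Finset.squarefree_prod_of_pairwise_isCoprime
      (fun p hp q hq hpq ↦ Nat.coprime_iff_isRelPrime.1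
        ((Nat.coprime_primes (hprime p hp) (hprime q hq)).2 hpq))
      fun p hp ↦ (hprime p hp).squarefree
  let F : ArithmeticFunction ℝ := ⟨fun d ↦ if d = 0 then 0 else 1 / (d : ℝ) ^ l, if_pos rfl⟩
  have hF : ∀ d, d ≠ 0 → F d = 1 / (d : ℝ) ^ l := fun d hd ↦ if_neg hd
  have hmul : F.IsMultiplicative := by
    rw [IsMultiplicative.iff_ne_zero]
    refine ⟨by simp [hF], fun {a b} ha hb _ ↦ ?_⟩
    rw [hF _ (mul_ne_zero ha hb), hF _ ha, hF _ hb]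
    push_cast
    rw [mul_pow, one_div_mul_one_div]
  have h := hmul.prodPrimeFactors_one_sub_of_squarefree F hrs
  rw [hrf] at h
  rw [Finset.prod_congr rfl fun p hp ↦ by rw [← hF p (hprime p hp).ne_zero], h]
  symm
  rw [← Finset.sum_subset (Nat.divisors_subset_of_dvd hn hrn)]
  · refine Finset.sum_congr rfl fun d hd ↦ ?_
    rw [hF d (Nat.pos_of_mem_divisors hd).ne', mul_one_div]
  · intro d hd hdr
    have : ¬ Squarefree d := by
      intro hs
      apply hdr
      rw [Nat.mem_divisors]
      refine ⟨?_, hrs.ne_zero⟩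
      rw [← Nat.prod_primeFactors_of_squarefree hs]
      exact Finset.prod_dvd_prod_of_subset _ _ _
        (Nat.primeFactors_mono (Nat.dvd_of_mem_divisors hd) hn)
    rw [moebius_eq_zero_of_not_squarefree this]
    simp

/-- The sum of `n⁻ᵐ` over the nonzero integers `n` in the residue class `a` modulo `N`. -/
noncomputable def residueSum (m N : ℕ) (a : ZMod N) : ℝ :=
  ∑' n : ℤ, if (n : ZMod N) = a then 1 / (n : ℝ) ^ m else 0

theorem summable_residueSum {m : ℕ} (hm : 2 ≤ m) {N : ℕ} (a : ZMod N) :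
    Summable fun n : ℤ ↦ if (n : ZMod N) = a then 1 / (n : ℝ) ^ m else 0 := by
  refine (((Real.summable_one_div_int_pow (p := m)).2 (by omega)).indicator
    {n : ℤ | (n : ZMod N) = a}).congr fun n ↦ ?_
  simp [Set.indicator_apply]

theorem hasSum_mul_one_div_pow {m : ℕ} (hm : 2 ≤ m) {N : ℕ} [NeZero N] (w : ZMod N → ℂ) :
    HasSum (fun n : ℤ ↦ w n * (1 / (n : ℂ) ^ m)) (∑ a, w a * residueSum m N a) := by
  have h := hasSum_sum (s := Finset.univ) fun a _ ↦
    (Complex.hasSum_ofReal.2 (summable_residueSum hm a).hasSum).mul_left (w a)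
  refine h.congr_fun fun n ↦ ?_
  rw [Finset.sum_eq_single_of_mem (n : ZMod N) (Finset.mem_univ _)]
  · simp
  · intro b _ hb
    simp [hb.symm]

theorem residueSum_mul_left (m : ℕ) {d : ℕ} (hd : d ≠ 0) (e b : ℕ) :
    residueSum m (d * e) ((d * b : ℕ) : ZMod (d * e)) =
      residueSum m e (b : ZMod e) / (d : ℝ) ^ m := by
  have hinj : Function.Injective fun n : ℤ ↦ (d : ℤ) * n :=
    mul_right_injective₀ (Nat.cast_ne_zero.2 hd)
  have hiff : ∀ n : ℤ, (((d : ℤ) * n : ℤ) : ZMod (d * e)) = ((d * b : ℕ) : ZMod (d * e)) ↔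
      (n : ZMod e) = (b : ZMod e) := by
    intro n
    rw [← Int.cast_natCast (d * b), ← Int.cast_natCast b, ZMod.intCast_eq_intCast_iff_dvd_sub,
      ZMod.intCast_eq_intCast_iff_dvd_sub]
    push_cast
    rw [← mul_sub, mul_dvd_mul_iff_left (Nat.cast_ne_zero.2 hd)]
  rw [residueSum, ← hinj.tsum_eq, residueSum, ← tsum_div_const]
  · refine tsum_congr fun n ↦ ?_
    simp only [hiff, ite_div, zero_div]
    push_cast
    rw [mul_pow, div_div, mul_comm]
  · intro n hn
    have hn' : (n : ZMod (d * e)) = ((d * b : ℕ) : ZMod (d * e)) := by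
      by_contra h
      exact hn (if_neg h)
    rw [← Int.cast_natCast (d * b), ZMod.intCast_eq_intCast_iff_dvd_sub] at hn'
    push_cast at hn'
    have : (d : ℤ) ∣ n := by
      have h1 : (d : ℤ) ∣ d * b - n := (dvd_mul_right _ _).trans hn'
      exact (dvd_sub_right (dvd_mul_right _ _)).1 h1
    obtain ⟨k, rfl⟩ := this
    exact ⟨k, rfl⟩

theorem sum_zmod_eq_sum_range {M : Type*} [AddCommMonoid M] {N : ℕ} [NeZero N] (F : ZMod N → M) :
    ∑ a, F a = ∑ j ∈ Finset.range N, F j := by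
  refine (Finset.sum_nbij (fun j : ℕ ↦ (j : ZMod N)) (fun _ _ ↦ Finset.mem_univ _) ?_ ?_
    fun _ _ ↦ rfl).symm
  · intro a ha b hb hab
    simp only [Finset.coe_range, Set.mem_Iio] at ha hb
    have := (ZMod.natCast_eq_natCast_iff' a b N).1 hab
    rwa [Nat.mod_eq_of_lt ha, Nat.mod_eq_of_lt hb] at this
  · intro a _
    exact ⟨a.val, by simpa using a.val_lt, by simp⟩

theorem sum_stdAddChar_mul_residueSum {m : ℕ} (hm : 2 ≤ m) {N : ℕ} [NeZero N] {j : ℕ} (hj : j < N) :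
    ∑ a : ZMod N, ZMod.stdAddChar ((j : ZMod N) * a) * (residueSum m N a : ℂ) =
      -(2 * π * Complex.I) ^ m / m.factorial * bernoulliFun m (j / N) := by
  have hN : (0 : ℝ) < N := Nat.cast_pos.2 (NeZero.pos N)
  have hx : (j / N : ℝ) ∈ Set.Icc (0 : ℝ) 1 :=
    ⟨by positivity, (div_le_one hN).2 (Nat.cast_le.2 hj.le)⟩
  refine (hasSum_mul_one_div_pow hm fun a ↦ ZMod.stdAddChar ((j : ZMod N) * a)).unique
    ((hasSum_one_div_pow_mul_fourier_mul_bernoulliFun hm hx).congr_fun fun n ↦ ?_)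
  have : ((j : ZMod N) * (n : ZMod N)) = ((j * n : ℤ) : ZMod N) := by push_cast; rfl
  rw [this, ZMod.stdAddChar_coe, fourier_coe_apply, mul_comm]
  congr 2
  push_cast
  ring

/-- Parseval's identity on `ZMod N` for real-valued functions. -/
theorem sum_norm_sq_sum_stdAddChar {N : ℕ} [NeZero N] (G : ZMod N → ℝ) :
    ∑ j : ZMod N, ‖∑ a : ZMod N, ZMod.stdAddChar (j * a) * (G a : ℂ)‖ ^ 2 =
      N * ∑ a, G a ^ 2 := by
  rw [← Complex.ofReal_inj]
  push_cast
  have hconj : ∀ a : ZMod N, starRingEnd ℂ (ZMod.stdAddChar a) = ZMod.stdAddChar (-a) := by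
    intro a
    rw [AddChar.map_neg_eq_inv, Complex.inv_eq_conj]
    simp
  simp only [← Complex.mul_conj', map_sum, map_mul, Complex.conj_ofReal, hconj,
    Finset.sum_mul_sum]
  rw [Finset.sum_comm, Finset.mul_sum]
  refine Finset.sum_congr rfl fun a _ ↦ ?_
  rw [Finset.sum_comm, Finset.sum_eq_single_of_mem a (Finset.mem_univ _)]
  · have : ∀ j : ZMod N, ZMod.stdAddChar (j * a) * (G a : ℂ) * (ZMod.stdAddChar (-(j * a)) * G a) =
        (G a : ℂ) ^ 2 := by
      intro j
      rw [mul_mul_mul_comm, ← AddChar.map_add_eq_mul]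
      simp [sq]
    simp [this]
  · intro b _ hb
    have : ∀ j : ZMod N, ZMod.stdAddChar (j * a) * (G a : ℂ) * (ZMod.stdAddChar (-(j * b)) * G b) =
        ZMod.stdAddChar (j * (a - b)) * (G a * G b) := by
      intro j
      rw [mul_mul_mul_comm, ← AddChar.map_add_eq_mul, ← sub_eq_add_neg, mul_sub]
    simp only [this, ← Finset.sum_mul]
    rw [AddChar.sum_mulShift _ (ZMod.isPrimitive_stdAddChar N), if_neg (sub_ne_zero.2 hb.symm)]
    simp

theorem sum_residueSum_sq {m : ℕ} (hm : 2 ≤ m) {N : ℕ} [NeZero N] :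
    ∑ a : ZMod N, residueSum m N a ^ 2 = (2 * π) ^ (2 * m) / (m.factorial : ℝ) ^ 2 *
      ((∑ j ∈ Finset.range N, bernoulliFun m (j / N) ^ 2) / N) := by
  have hN : (N : ℝ) ≠ 0 := NeZero.ne _
  have h := sum_norm_sq_sum_stdAddChar (residueSum m N)
  rw [sum_zmod_eq_sum_range] at h
  have h2 : ∀ j ∈ Finset.range N,
      ‖∑ a : ZMod N, ZMod.stdAddChar ((j : ZMod N) * a) * (residueSum m N a : ℂ)‖ ^ 2 =
      (2 * π) ^ (2 * m) / (m.factorial : ℝ) ^ 2 * bernoulliFun m (j / N) ^ 2 := by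
    intro j hj
    rw [sum_stdAddChar_mul_residueSum hm (Finset.mem_range.1 hj)]
    simp only [norm_mul, norm_div, norm_neg, norm_pow, Complex.norm_I, Complex.norm_real,
      Complex.norm_natCast, Complex.norm_ofNat, Real.norm_eq_abs, mul_pow, div_pow, sq_abs,
      abs_of_pos Real.pi_pos]
    ring
  rw [Finset.sum_congr rfl h2, ← Finset.mul_sum] at h
  rw [← mul_right_inj' hN, ← h]
  field_simp

theorem hasSum_int_dirichletCharacter {m f : ℕ} (hm : 2 ≤ m) [NeZero f]
    (χ : DirichletCharacter ℂ f) :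
    HasSum (fun n : ℤ ↦ χ n * (1 / (n : ℂ) ^ m))
      ((1 + χ (-1) * (-1) ^ m) * χ.LFunction m) := by
  have hs : 1 < (m : ℂ).re := by
    rw [Complex.natCast_re]
    exact_mod_cast hm
  have h : HasSum (fun n : ℕ ↦ χ n * (1 / (n : ℂ) ^ m)) (χ.LFunction m) := by
    rw [DirichletCharacter.LFunction_eq_LSeries χ hs]
    refine (DirichletCharacter.LSeriesSummable_of_one_lt_re χ hs).hasSum.congr_fun fun n ↦ ?_
    rw [LSeries.term_def, Complex.cpow_natCast, mul_one_div]
    split_ifs with hn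
    · simp [hn, show m ≠ 0 by omega]
    · rfl
  have h1 : HasSum (fun n : ℕ ↦ χ (n + 1 : ℕ) * (1 / ((n + 1 : ℕ) : ℂ) ^ m)) (χ.LFunction m) := by
    rw [hasSum_nat_add_iff' 1 |>.symm] at h
    simpa [show m ≠ 0 by omega] using h
  rw [add_mul, one_mul]
  refine HasSum.of_nat_of_neg_add_one (by simpa using h) ?_
  refine (h1.mul_left (χ (-1) * (-1) ^ m)).congr_fun fun n ↦ ?_
  have e1 : ((-((n : ℤ) + 1) : ℤ) : ZMod f) = -1 * (n + 1 : ℕ) := by push_cast; ring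
  have e2 : ((-((n : ℤ) + 1) : ℤ) : ℂ) = -1 * (n + 1 : ℕ) := by push_cast; ring
  rw [e1, e2, map_mul, mul_pow]
  rcases neg_one_pow_eq_or ℂ m with h | h <;> rw [h] <;> ring

theorem sum_dirichletCharacter_mul_residueSum {m f : ℕ} (hm : 2 ≤ m) [NeZero f]
    (χ : DirichletCharacter ℂ f) :
    ∑ a : ZMod f, χ a * (residueSum m f a : ℂ) =
      if χ (-1) = (-1) ^ m then 2 * χ.LFunction m else 0 := by
  rw [(hasSum_mul_one_div_pow hm χ).unique (hasSum_int_dirichletCharacter hm χ)]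
  have h1 : χ (-1) * χ (-1) = 1 := by rw [← map_mul]; simp
  have h2 : ((-1 : ℂ) ^ m) * (-1) ^ m = 1 := by rw [← mul_pow]; simp
  split_ifs with h
  · rw [h, h2]; norm_num
  · rcases mul_self_eq_mul_self_iff.1 (h1.trans h2.symm) with h3 | h3
    · exact absurd h3 h
    · rw [h3, neg_mul, h2]; simp

/-- Parseval's identity for Dirichlet characters. -/
theorem sum_dirichletCharacter_norm_sq {f : ℕ} [NeZero f] (G : ZMod f → ℝ) :
    ∑ χ : DirichletCharacter ℂ f, ((‖∑ a : ZMod f, χ a * (G a : ℂ)‖ : ℂ) ^ 2) =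
      f.totient * ∑ a : ZMod f with IsUnit a, ((G a : ℂ) ^ 2) := by
  have hconj : ∀ (χ : DirichletCharacter ℂ f) (a : ZMod f), IsUnit a →
      starRingEnd ℂ (χ a) = χ a⁻¹ := by
    intro χ a ha
    have hn : ‖χ a‖ = 1 := χ.unit_norm_eq_one ha.unit
    rw [← Complex.inv_eq_conj hn]
    refine inv_eq_of_mul_eq_one_right ?_
    rw [← map_mul, ZMod.mul_inv_of_unit a ha, map_one]
  have hsum : ∀ χ : DirichletCharacter ℂ f, ∑ a : ZMod f, χ a * (G a : ℂ) =
      ∑ a : ZMod f with IsUnit a, χ a * (G a : ℂ) := by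
    intro χ
    rw [Finset.sum_filter]
    refine Finset.sum_congr rfl fun a _ ↦ ?_
    split_ifs with ha
    · rfl
    · rw [χ.map_nonunit ha, zero_mul]
  simp only [← Complex.conj_mul', hsum, map_sum, map_mul, Complex.conj_ofReal, Finset.sum_mul_sum]
  rw [Finset.sum_comm, Finset.mul_sum]
  refine Finset.sum_congr rfl fun a ha ↦ ?_
  have hu : IsUnit a := (Finset.mem_filter.1 ha).2
  have h : ∀ b, ∑ χ : DirichletCharacter ℂ f,
      starRingEnd ℂ (χ a) * (G a : ℂ) * (χ b * G b) =
      (if a = b then (f.totient : ℂ) else 0) * (G a * G b) := by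
    intro b
    rw [← DirichletCharacter.sum_char_inv_mul_char_eq ℂ hu b, Finset.sum_mul]
    refine Finset.sum_congr rfl fun χ _ ↦ ?_
    rw [hconj χ a hu]
    ring
  rw [Finset.sum_comm, Finset.sum_congr rfl fun b _ ↦ h b]
  simp [ha, sq]

/-- The mean value of `|L(m,χ)|²` as a sum of squares over reduced residue classes. -/
theorem mean_LFunction_norm_sq_eq {m f : ℕ} (hm : 2 ≤ m) [NeZero f] :
    (2 / (Nat.totient f : ℂ)) *
      ∑ χ ∈ Finset.univ.filter
          (fun χ : DirichletCharacter ℂ f => χ (-1) = (-1) ^ m),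
        ((‖χ.LFunction m‖ : ℂ) ^ 2) =
      (((∑ j ∈ Finset.range f with j.Coprime f, residueSum m f j ^ 2) / 2 : ℝ) : ℂ) := by
  have h := sum_dirichletCharacter_norm_sq (residueSum m f)
  have h1 : ∀ χ : DirichletCharacter ℂ f,
      ((‖∑ a : ZMod f, χ a * (residueSum m f a : ℂ)‖ : ℂ) ^ 2) =
      if χ (-1) = (-1) ^ m then 4 * ((‖χ.LFunction m‖ : ℂ) ^ 2) else 0 := by
    intro χ
    rw [sum_dirichletCharacter_mul_residueSum hm]
    split_ifs with hχ
    · rw [norm_mul]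
      push_cast
      norm_num [mul_pow]
    · simp
  rw [Finset.sum_congr rfl fun χ _ ↦ h1 χ, ← Finset.sum_filter, ← Finset.mul_sum,
    Finset.sum_filter IsUnit, sum_zmod_eq_sum_range] at h
  simp only [ZMod.isUnit_iff_coprime] at h
  rw [← Finset.sum_filter] at h
  have ht : (f.totient : ℂ) ≠ 0 :=
    Nat.cast_ne_zero.2 (Nat.totient_pos.2 (NeZero.pos f)).ne'
  push_cast
  field_simp
  linear_combination h

theorem sum_range_bernoulliFun_div (r : ℕ) {N : ℕ} (hN : N ≠ 0) :
    (∑ j ∈ Finset.range N, bernoulliFun r (j / N)) / N = bernoulli r / (N : ℝ) ^ r := by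
  have hN' : (N : ℝ) ≠ 0 := Nat.cast_ne_zero.2 hN
  have h := bernoulliFun_mul r hN 0
  simp only [mul_zero, zero_add, bernoulliFun_eval_zero] at h
  rw [h]
  field_simp

theorem sum_range_bernoulliFun_sq_div {m : ℕ} (hm : 1 ≤ m) {N : ℕ} (hN : N ≠ 0) :
    (∑ j ∈ Finset.range N, bernoulliFun m (j / N) ^ 2) / N =
      (-1) ^ (m - 1) * ((m.factorial : ℝ) ^ 2 / (2 * m).factorial) * bernoulli (2 * m) +
      ∑ k ∈ Finset.range (m / 2 + 1), (m : ℝ) / ((m - k : ℕ) : ℝ) * (m.choose (2 * k)) *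
        bernoulli (2 * k) * bernoulli (2 * (m - k)) / (N : ℝ) ^ (2 * (m - k)) := by
  have hN' : (N : ℝ) ≠ 0 := Nat.cast_ne_zero.2 hN
  simp only [bernoulliFun_sq m hm, Finset.sum_add_distrib, add_div]
  congr 1
  · simp
    field_simp
  · rw [Finset.sum_comm, Finset.sum_div]
    refine Finset.sum_congr rfl fun k _ ↦ ?_
    rw [← Finset.mul_sum, mul_div_assoc, sum_range_bernoulliFun_div _ hN, mul_div_assoc]

theorem sum_coprime_residueSum_sq {m f : ℕ} (hm : 2 ≤ m) (hf : 1 < f) :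
    ∑ j ∈ Finset.range f with j.Coprime f, residueSum m f j ^ 2 =
      (2 * π) ^ (2 * m) / (m.factorial : ℝ) ^ 2 *
      ((-1) ^ (m - 1) * ((m.factorial : ℝ) ^ 2 / (2 * m).factorial) * bernoulli (2 * m) *
          ∏ p ∈ f.primeFactors, (1 - 1 / (p : ℝ) ^ (2 * m)) +
        ∑ k ∈ Finset.Icc 1 (m / 2), (m : ℝ) / ((m - k : ℕ) : ℝ) * (m.choose (2 * k)) *
          bernoulli (2 * k) * bernoulli (2 * (m - k)) / (f : ℝ) ^ (2 * (m - k)) *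
          ∏ p ∈ f.primeFactors, (1 - 1 / (p : ℝ) ^ (2 * k))) := by
  have hf0 : f ≠ 0 := by omega
  rw [sum_range_coprime_eq_sum_moebius hf0 fun j ↦ residueSum m f j ^ 2]
  have h : ∀ d ∈ f.divisors, (ArithmeticFunction.moebius d : ℝ) *
      ∑ b ∈ Finset.range (f / d), residueSum m f ((d * b : ℕ) : ZMod f) ^ 2 =
      (2 * π) ^ (2 * m) / (m.factorial : ℝ) ^ 2 *
      ((-1) ^ (m - 1) * ((m.factorial : ℝ) ^ 2 / (2 * m).factorial) * bernoulli (2 * m) *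
          (ArithmeticFunction.moebius d / (d : ℝ) ^ (2 * m)) +
        ∑ k ∈ Finset.range (m / 2 + 1), (m : ℝ) / ((m - k : ℕ) : ℝ) * (m.choose (2 * k)) *
          bernoulli (2 * k) * bernoulli (2 * (m - k)) / (f : ℝ) ^ (2 * (m - k)) *
          (ArithmeticFunction.moebius d / (d : ℝ) ^ (2 * k))) := by
    intro d hd
    obtain ⟨e, rfl⟩ := Nat.dvd_of_mem_divisors hd
    obtain ⟨hd0, he0⟩ := mul_ne_zero_iff.1 hf0
    have hd0' : (d : ℝ) ≠ 0 := Nat.cast_ne_zero.2 hd0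
    have he0' : (e : ℝ) ≠ 0 := Nat.cast_ne_zero.2 he0
    have : NeZero e := ⟨he0⟩
    rw [Nat.mul_div_cancel_left e (Nat.pos_of_ne_zero hd0)]
    simp only [residueSum_mul_left m hd0, div_pow, ← Finset.sum_div]
    rw [← sum_zmod_eq_sum_range fun b ↦ residueSum m e b ^ 2, sum_residueSum_sq hm,
      sum_range_bernoulliFun_sq_div (by omega) he0, mul_div_assoc, mul_left_comm, add_div, mul_add,
      Finset.sum_div, Finset.mul_sum]
    congr 2
    · ring
    · refine Finset.sum_congr rfl fun k hk ↦ ?_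
      have hk' : 2 * m = 2 * (m - k) + 2 * k := by simp at hk; omega
      rw [← pow_mul, mul_comm m 2, hk', pow_add]
      push_cast
      rw [mul_pow]
      field_simp
  rw [Finset.sum_congr rfl h, ← Finset.mul_sum, Finset.sum_add_distrib, ← Finset.mul_sum,
    Finset.sum_comm, sum_moebius_div_pow hf0]
  simp only [← Finset.mul_sum, sum_moebius_div_pow hf0]
  congr 2
  rw [Finset.range_eq_Ico, Finset.sum_eq_sum_Ico_succ_bot (Nat.succ_pos _)]
  have h0 : ∏ p ∈ f.primeFactors, (1 - 1 / (p : ℝ) ^ (2 * 0)) = 0 := by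
    obtain ⟨p, hp⟩ := Nat.nonempty_primeFactors.2 hf
    exact Finset.prod_eq_zero hp (by simp)
  rw [h0, mul_zero, zero_add]
  rfl

/-- **Explicit mean value of `|L(m,χ)|²` for `m ≥ 2`.**
For `f > 2` and `m ≥ 2`,
`M(m,f) = (2/φ(f)) ∑_{χ(-1)=(-1)^m} |L(m,χ)|²`
equals
`ζ(2m) (φ_{2m}(f) + (-1)^{m-1} C(2m,m) ∑_{k=1}^{⌊m/2⌋} (m/(m-k)) C(m,2k)
  (B_{2k} B_{2(m-k)} / B_{2m}) φ_{2k}(f)/f^{2m-2k})`,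
where `φ_l(f) = ∏_{p ∣ f} (1 - 1/p^l)` and `B_k` are the Bernoulli numbers. -/
theorem mean_value_L_m_sq (m f : ℕ) (hm : 2 ≤ m) [NeZero f] (hf : 2 < f) :
    (2 / (Nat.totient f : ℂ)) *
      ∑ χ ∈ Finset.univ.filter
          (fun χ : DirichletCharacter ℂ f => χ (-1) = (-1) ^ m),
        ((‖χ.LFunction m‖ : ℂ) ^ 2)
    = riemannZeta (2 * m) *
        ((∏ p ∈ f.primeFactors, (1 - 1 / (p : ℂ) ^ (2 * m)))
          + (-1) ^ (m - 1) * (Nat.choose (2 * m) m : ℂ) *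
            ∑ k ∈ Finset.Icc 1 (m / 2),
              ((m : ℂ) / ((m - k : ℕ) : ℂ)) * (Nat.choose m (2 * k) : ℂ) *
                ((bernoulli (2 * k) : ℂ) * (bernoulli (2 * (m - k)) : ℂ) /
                  (bernoulli (2 * m) : ℂ)) *
                (∏ p ∈ f.primeFactors, (1 - 1 / (p : ℂ) ^ (2 * k))) /
                  (f : ℂ) ^ (2 * m - 2 * k)) := by
  have hB : (bernoulli (2 * m) : ℂ) ≠ 0 := by
    intro h
    have hz := riemannZeta_two_mul_nat (k := m) (by omega)
    rw [h] at hz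
    refine riemannZeta_ne_zero_of_one_lt_re (s := 2 * m) ?_ (by simpa using hz)
    rw [show (2 * m : ℂ) = ((2 * m : ℕ) : ℂ) by push_cast; rfl, Complex.natCast_re]
    exact_mod_cast (by omega : 1 < 2 * m)
  have hchoose : ((2 * m).choose m : ℂ) = (2 * m).factorial / (m.factorial : ℂ) ^ 2 := by
    have h := Nat.choose_mul_factorial_mul_factorial (show m ≤ 2 * m by omega)
    rw [show 2 * m - m = m by omega] at h
    rw [← h]
    have := m.factorial_ne_zero
    push_cast
    field_simp
  have hm0 : (m.factorial : ℂ) ≠ 0 := Nat.cast_ne_zero.2 m.factorial_ne_zero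
  have hm1 : ((2 * m).factorial : ℂ) ≠ 0 := Nat.cast_ne_zero.2 (2 * m).factorial_ne_zero
  have hsign : ((-1 : ℂ) ^ (m - 1)) * (-1) ^ (m - 1) = 1 := by rw [← mul_pow]; simp
  have hpow : ((-1 : ℂ) ^ (m + 1)) = (-1) ^ (m - 1) := by
    rw [show m + 1 = m - 1 + 2 by omega, pow_add]; simp
  have hpi : (2 : ℂ) ^ (2 * m - 1) * 2 = 2 ^ (2 * m) := by
    rw [← pow_succ, show 2 * m - 1 + 1 = 2 * m by omega]
  rw [mean_LFunction_norm_sq_eq hm, sum_coprime_residueSum_sq hm (by omega),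
    riemannZeta_two_mul_nat (by omega), hpow, hchoose]
  push_cast
  set S : ℂ := ∑ k ∈ Finset.Icc 1 (m / 2), (m : ℂ) / ((m - k : ℕ) : ℂ) * (m.choose (2 * k)) *
      bernoulli (2 * k) * bernoulli (2 * (m - k)) / (f : ℂ) ^ (2 * (m - k)) *
      ∏ p ∈ f.primeFactors, (1 - 1 / (p : ℂ) ^ (2 * k)) with hS
  set P : ℂ := ∏ p ∈ f.primeFactors, (1 - 1 / (p : ℂ) ^ (2 * m))
  have hsum : ∑ k ∈ Finset.Icc 1 (m / 2), (m : ℂ) / ((m - k : ℕ) : ℂ) * (m.choose (2 * k)) *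
        ((bernoulli (2 * k) : ℂ) * bernoulli (2 * (m - k)) / bernoulli (2 * m)) *
        (∏ p ∈ f.primeFactors, (1 - 1 / (p : ℂ) ^ (2 * k))) / (f : ℂ) ^ (2 * m - 2 * k) =
      S / bernoulli (2 * m) := by
    rw [hS, Finset.sum_div]
    refine Finset.sum_congr rfl fun k _ ↦ ?_
    rw [Nat.mul_sub]
    ring
  rw [hsum, mul_pow, ← hpi]
  clear_value S P
  generalize (-1 : ℂ) ^ (m - 1) = s at *
  field_simp
  linear_combination (-((2 * m).factorial : ℂ) * S) * hsign
end

section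
/- For every rational integer $f>2$, $\frac{2}{\phi(f)}\sum_{\chi\bmod f,\ \chi(-1)=1}\vert L(2,\chi)\vert^2=\frac{\pi^4}{90}\left(\phi_4(f)+10\frac{\phi_2(f)}{f^2}\right)$, the sum being over the $\phi(f)/2$ even Dirichlet characters modulo $f$. -/
open scoped Classical Real

open HurwitzZeta ComplexConjugate

section IntegerShifts

variable {x : ℝ}

lemma summable_int_add_inv_sq (x : ℝ) : Summable fun n : ℤ ↦ ((n + x : ℝ)⁻¹) ^ 2 := by
  have h := (hasSum_int_hurwitzZetaEven x (s := 2) (by simp)).summable.norm.mul_left 2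
  refine h.congr fun n ↦ ?_
  have : (2 : ℂ) = ((2 : ℕ) : ℂ) := by simp
  rw [norm_div, norm_div, this, Complex.cpow_natCast]
  simp
  ring

lemma summable_int_mul_shift {u : ℤ → ℝ} (hu : Summable fun n ↦ u n ^ 2) (d : ℤ) :
    Summable fun n ↦ u n * u (n + d) := by
  have hd : Summable fun n ↦ u (n + d) ^ 2 :=
    (Equiv.addRight d).summable_iff (f := fun n ↦ u n ^ 2) |>.mpr hu
  refine Summable.of_norm_bounded (hu.add hd) fun n ↦ ?_
  rw [norm_mul, Real.norm_eq_abs, Real.norm_eq_abs]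
  nlinarith [sq_nonneg (|u n| - |u (n + d)|), sq_abs (u n), sq_abs (u (n + d)),
    sq_nonneg (u n), sq_nonneg (u (n + d))]

lemma inv_int_add_sub_shift (hx : ∀ n : ℤ, (n + x : ℝ) ≠ 0) (d n : ℤ) :
    (n + x : ℝ)⁻¹ - (((n + d : ℤ) : ℝ) + x)⁻¹
      = d * ((n + x : ℝ)⁻¹ * (((n + d : ℤ) : ℝ) + x)⁻¹) := by
  have h₁ := hx n
  have h₂ := hx (n + d)
  field_simp
  push_cast
  ring

lemma summable_inv_int_add_sub_shift (hx : ∀ n : ℤ, (n + x : ℝ) ≠ 0) (d : ℤ) :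
    Summable fun n : ℤ ↦ (n + x : ℝ)⁻¹ - (((n + d : ℤ) : ℝ) + x)⁻¹ := by
  simp_rw [inv_int_add_sub_shift hx d]
  exact (summable_int_mul_shift (summable_int_add_inv_sq x) d).mul_left _

lemma hasSum_inv_int_add_sub_succ (hx : ∀ n : ℤ, (n + x : ℝ) ≠ 0) :
    HasSum (fun n : ℤ ↦ (n + x : ℝ)⁻¹ - (((n + 1 : ℤ) : ℝ) + x)⁻¹) 0 := by
  have hs := summable_inv_int_add_sub_shift hx 1
  have h₁ : HasSum (fun n : ℕ ↦ (((n : ℤ) : ℝ) + x)⁻¹ - ((((n : ℤ) + 1 : ℤ) : ℝ) + x)⁻¹) x⁻¹ := by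
    refine (hs.comp_injective (i := ((↑) : ℕ → ℤ)) Nat.cast_injective).hasSum_iff_tendsto_nat.mpr ?_
    simp only [Function.comp_apply]
    have (n : ℕ) : ∑ i ∈ Finset.range n,
        ((((i : ℤ) : ℝ) + x)⁻¹ - ((((i : ℤ) + 1 : ℤ) : ℝ) + x)⁻¹) = x⁻¹ - ((n : ℝ) + x)⁻¹ := by
      simpa using Finset.sum_range_sub' (fun i : ℕ ↦ ((i : ℝ) + x)⁻¹) n
    simp_rw [this]
    simpa using tendsto_const_nhds.sub (tendsto_inv_atTop_zero.comp
      (Filter.tendsto_atTop_add_const_right _ x tendsto_natCast_atTop_atTop))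
  have h₂ : HasSum (fun n : ℕ ↦ (((-(n + 1 : ℤ) : ℤ) : ℝ) + x)⁻¹
      - (((-(n + 1 : ℤ) + 1 : ℤ) : ℝ) + x)⁻¹) (-x⁻¹) := by
    refine (hs.comp_injective (i := fun n : ℕ ↦ -(n + 1 : ℤ))
      fun a b h ↦ by simpa using h).hasSum_iff_tendsto_nat.mpr ?_
    simp only [Function.comp_apply]
    have (n : ℕ) : ∑ i ∈ Finset.range n, ((((-(i + 1 : ℤ) : ℤ) : ℝ) + x)⁻¹
        - (((-(i + 1 : ℤ) + 1 : ℤ) : ℝ) + x)⁻¹) = (-(n : ℝ) + x)⁻¹ - x⁻¹ := by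
      simpa using Finset.sum_range_sub (fun i : ℕ ↦ (-(i : ℝ) + x)⁻¹) n
    simp_rw [this]
    simpa using (tendsto_inv_atBot_zero.comp (Filter.tendsto_atBot_add_const_right _ x
      (Filter.tendsto_neg_atTop_atBot.comp tendsto_natCast_atTop_atTop))).sub
      (tendsto_const_nhds (x := x⁻¹))
  rw [← add_neg_cancel x⁻¹]
  exact HasSum.of_nat_of_neg_add_one
    (f := fun n : ℤ ↦ (n + x : ℝ)⁻¹ - (((n + 1 : ℤ) : ℝ) + x)⁻¹) h₁ h₂

lemma hasSum_inv_int_add_sub_shift (hx : ∀ n : ℤ, (n + x : ℝ) ≠ 0) (d : ℤ) :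
    HasSum (fun n : ℤ ↦ (n + x : ℝ)⁻¹ - (((n + d : ℤ) : ℝ) + x)⁻¹) 0 := by
  have key (e : ℤ) : HasSum (fun n : ℤ ↦
      (((n + e : ℤ) : ℝ) + x)⁻¹ - (((n + e + 1 : ℤ) : ℝ) + x)⁻¹) 0 :=
    (Equiv.addRight e).hasSum_iff (f := fun n : ℤ ↦
      (n + x : ℝ)⁻¹ - (((n + 1 : ℤ) : ℝ) + x)⁻¹) |>.mpr (hasSum_inv_int_add_sub_succ hx)
  induction d using Int.induction_on with
  | zero => simp
  | succ i ih =>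
    refine (add_zero (0 : ℝ) ▸ ih.add (key i)).congr_fun fun n ↦ ?_
    rw [← add_assoc]; ring
  | pred i ih =>
    refine (sub_zero (0 : ℝ) ▸ ih.sub (key (-i - 1))).congr_fun fun n ↦ ?_
    rw [show n + (-(i : ℤ) - 1) + 1 = n + -i by ring]; ring

lemma hasSum_inv_sq_mul_shift (hx : ∀ n : ℤ, (n + x : ℝ) ≠ 0) {d : ℤ} (hd : d ≠ 0) :
    HasSum (fun n : ℤ ↦ ((n + x : ℝ)⁻¹) ^ 2 * ((((n + d : ℤ) : ℝ) + x)⁻¹) ^ 2)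
      (2 * (∑' n : ℤ, ((n + x : ℝ)⁻¹) ^ 2) * (1 / (d : ℝ) ^ 2)) := by
  have hd' : (d : ℝ) ≠ 0 := by exact_mod_cast hd
  have h₀ := (summable_int_add_inv_sq x).hasSum
  have h₁ : HasSum (fun n : ℤ ↦ ((((n + d : ℤ) : ℝ) + x)⁻¹) ^ 2) _ :=
    (Equiv.addRight d).hasSum_iff (f := fun n : ℤ ↦ ((n + x : ℝ)⁻¹) ^ 2) |>.mpr h₀
  have h₂ := (hasSum_inv_int_add_sub_shift hx d).mul_left (2 / (d : ℝ))
  convert! ((h₀.add h₁).sub h₂).mul_left (1 / (d : ℝ) ^ 2) using 1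
  · ext n
    have h := inv_int_add_sub_shift hx d n
    have h' : (n + x : ℝ)⁻¹ * (((n + d : ℤ) : ℝ) + x)⁻¹
        = ((n + x : ℝ)⁻¹ - (((n + d : ℤ) : ℝ) + x)⁻¹) / d := by
      rw [h]; field_simp
    generalize (n + x : ℝ)⁻¹ = a at *
    generalize (((n + d : ℤ) : ℝ) + x)⁻¹ = b at *
    have hb : b = a - d * (a * b) := by linarith
    have e : 2 / (d : ℝ) * (a - b) = 2 * (a * b) := by rw [h]; field_simp
    rw [e, ← mul_pow, h']
    field_simp
    linear_combination 2 * h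
  · ring

lemma hasSum_int_one_div_sq : HasSum (fun d : ℤ ↦ 1 / (d : ℝ) ^ 2) (π ^ 2 / 3) := by
  have h₁ : HasSum (fun n : ℕ ↦ 1 / (((n : ℤ) : ℝ)) ^ 2) (π ^ 2 / 6) := by
    simpa using hasSum_zeta_two
  have h₂ : HasSum (fun n : ℕ ↦ 1 / ((-(n + 1 : ℤ) : ℤ) : ℝ) ^ 2) (π ^ 2 / 6) := by
    have := (hasSum_nat_add_iff' 1).mpr hasSum_zeta_two
    simp only [Finset.range_one, Finset.sum_singleton, Nat.cast_zero] at this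
    convert! this using 1
    · ext n
      push_cast
      ring
    · simp
  convert! HasSum.of_nat_of_neg_add_one (f := fun d : ℤ ↦ 1 / (d : ℝ) ^ 2) h₁ h₂ using 1
  ring

lemma sq_tsum_int_add_inv_sq (hx : ∀ n : ℤ, (n + x : ℝ) ≠ 0) :
    (∑' n : ℤ, ((n + x : ℝ)⁻¹) ^ 2) ^ 2
      = ∑' n : ℤ, ((n + x : ℝ)⁻¹) ^ 4 + 2 * π ^ 2 / 3 * ∑' n : ℤ, ((n + x : ℝ)⁻¹) ^ 2 := by
  set G := ∑' n : ℤ, ((n + x : ℝ)⁻¹) ^ 2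
  set H := ∑' n : ℤ, ((n + x : ℝ)⁻¹) ^ 4 with hH
  have hs := summable_int_add_inv_sq x
  have hnonneg : (0 : ℤ → ℝ) ≤ fun n : ℤ ↦ ((n + x : ℝ)⁻¹) ^ 2 := by
    intro n
    positivity
  have hprod : HasSum (fun p : ℤ × ℤ ↦ ((p.1 + x : ℝ)⁻¹) ^ 2 * ((p.2 + x : ℝ)⁻¹) ^ 2) (G * G) :=
    HasSum.mul (f := fun n : ℤ ↦ ((n + x : ℝ)⁻¹) ^ 2) (g := fun n : ℤ ↦ ((n + x : ℝ)⁻¹) ^ 2)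
      hs.hasSum hs.hasSum (hs.mul_of_nonneg hs hnonneg hnonneg)
  let e : ℤ × ℤ ≃ ℤ × ℤ :=
    { toFun := fun p ↦ (p.2, p.2 + p.1)
      invFun := fun p ↦ (p.2 - p.1, p.1)
      left_inv := fun p ↦ by simp
      right_inv := fun p ↦ by simp }
  have hprod' : HasSum (fun p : ℤ × ℤ ↦
      ((p.2 + x : ℝ)⁻¹) ^ 2 * ((((p.2 + p.1 : ℤ) : ℝ) + x)⁻¹) ^ 2) (G * G) := by
    simpa only [Function.comp_def, e, Equiv.coe_fn_mk] using e.hasSum_iff.mpr hprod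
  have hdiag : Summable fun n : ℤ ↦ ((n + x : ℝ)⁻¹) ^ 4 := by
    have hinj : Function.Injective fun n : ℤ ↦ (n, n) := fun a b h ↦ (Prod.ext_iff.mp h).1
    simpa only [Function.comp_def, ← pow_add] using hprod.summable.comp_injective hinj
  have hfib (d : ℤ) : HasSum (fun n : ℤ ↦
      ((n + x : ℝ)⁻¹) ^ 2 * ((((n + d : ℤ) : ℝ) + x)⁻¹) ^ 2)
      (2 * G * (1 / (d : ℝ) ^ 2) + if d = 0 then H else 0) := by
    by_cases hd : d = 0
    · subst hd
      convert! hdiag.hasSum using 1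
      · ext n
        simp only [add_zero]
        ring
      · simp [hH]
    · rw [if_neg hd, add_zero]
      exact hasSum_inv_sq_mul_shift hx hd
  have h₁ := hprod'.prod_fiberwise hfib
  have h₂ := (hasSum_int_one_div_sq.mul_left (2 * G)).add (hasSum_ite_eq (0 : ℤ) H)
  have := h₁.unique h₂
  linear_combination this

end IntegerShifts

lemma hurwitzZetaEven_natCast_of_even {k : ℕ} (hk : Even k) (hk₁ : 1 < k) (x : ℝ) :
    hurwitzZetaEven x k = (((∑' n : ℤ, ((n + x : ℝ)⁻¹) ^ k) / 2 : ℝ) : ℂ) := by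
  rw [← (hasSum_int_hurwitzZetaEven x (s := k) (by simpa using hk₁)).tsum_eq, tsum_div_const]
  push_cast
  congr 2
  ext n
  rw [Complex.cpow_natCast, one_div, inv_pow]
  congr 1
  exact_mod_cast congrArg ((↑) : ℝ → ℂ) (hk.pow_abs ((n : ℝ) + x))

/-- The identity `E₂² = E₄ / 2 + (π² / 3) E₂` for the even Hurwitz zeta function at a
non-integral real point. -/
lemma hurwitzZetaEven_two_mul_conj {x : ℝ} (hx : ∀ n : ℤ, (n + x : ℝ) ≠ 0) :
    hurwitzZetaEven x 2 * conj (hurwitzZetaEven x 2)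
      = hurwitzZetaEven x 4 / 2 + π ^ 2 / 3 * hurwitzZetaEven x 2 := by
  have h₂ := hurwitzZetaEven_natCast_of_even (k := 2) (by decide) (by decide) x
  have h₄ := hurwitzZetaEven_natCast_of_even (k := 4) (by decide) (by decide) x
  rw [Nat.cast_ofNat] at h₂ h₄
  rw [h₂, h₄, Complex.conj_ofReal]
  have := sq_tsum_int_add_inv_sq hx
  norm_cast
  linear_combination this / 4

namespace DirichletCharacter

variable {N : ℕ} [NeZero N]

lemma sum_mul_conj_apply (a b : ZMod N) :
    ∑ χ : DirichletCharacter ℂ N, χ a * conj (χ b)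
      = if a = b then (N.totient : ℂ) * (1 : DirichletCharacter ℂ N) a else 0 := by
  by_cases hb : IsUnit b
  · have h (χ : DirichletCharacter ℂ N) : conj (χ b) = χ b⁻¹ := by
      have := MulChar.star_apply' χ b
      rw [starRingEnd_apply, this, MulChar.inv_apply]
      congr 1
      obtain ⟨u, rfl⟩ := hb
      rw [Ring.inverse_unit, ZMod.inv_coe_unit]
    rw [Finset.sum_congr rfl fun χ _ ↦ by rw [h, mul_comm], sum_char_inv_mul_char_eq ℂ hb a]
    by_cases hab : a = b
    · simp [hab, MulChar.one_apply hb]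
    · simp [hab, Ne.symm hab]
  · simp_rw [MulChar.map_nonunit _ hb, map_zero, mul_zero, Finset.sum_const_zero]
    split_ifs with hab
    · rw [hab, MulChar.map_nonunit _ hb, mul_zero]
    · rfl

/-- Parseval's identity for Dirichlet characters. -/
lemma sum_mul_conj_sum_apply_mul (E : ZMod N → ℂ) :
    ∑ χ : DirichletCharacter ℂ N, (∑ a, χ a * E a) * conj (∑ a, χ a * E a)
      = N.totient * ∑ a, (1 : DirichletCharacter ℂ N) a * (E a * conj (E a)) := by
  calc _ = ∑ a, ∑ b, (∑ χ : DirichletCharacter ℂ N, χ a * conj (χ b)) * (E a * conj (E b)) := by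
        simp_rw [map_sum, map_mul, Finset.sum_mul_sum, Finset.sum_mul]
        rw [Finset.sum_comm]
        refine Finset.sum_congr rfl fun a _ ↦ ?_
        rw [Finset.sum_comm]
        exact Finset.sum_congr rfl fun b _ ↦ Finset.sum_congr rfl fun χ _ ↦ by ring
    _ = _ := by
        simp_rw [sum_mul_conj_apply, ite_mul, zero_mul, Finset.sum_ite_eq, Finset.mem_univ,
          if_true, Finset.mul_sum, mul_assoc]

lemma LFunction_natCast_of_even {χ : DirichletCharacter ℂ N} (hχ : χ.Even) (k : ℕ) :
    χ.LFunction k = ((N : ℂ) ^ k)⁻¹ *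
      ∑ a, χ a * hurwitzZetaEven (ZMod.toAddCircle a) k := by
  rw [DirichletCharacter.LFunction, ZMod.LFunction_def_even hχ.to_fun, Complex.cpow_neg,
    Complex.cpow_natCast]

lemma sum_apply_mul_eq_zero_of_odd {χ : DirichletCharacter ℂ N} (hχ : χ.Odd) {E : ZMod N → ℂ}
    (hE : E.Even) : ∑ a, χ a * E a = 0 :=
  (hχ.to_fun.mul_even hE).sum_eq_zero

end DirichletCharacter

lemma int_add_val_div_ne_zero {N : ℕ} [NeZero N] {a : ZMod N} (ha : a ≠ 0) (n : ℤ) :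
    (n + (a.val / N : ℝ)) ≠ 0 := by
  intro h
  apply ha
  rw [← ZMod.toAddCircle_eq_zero, ZMod.toAddCircle_apply, AddCircle.coe_eq_zero_iff]
  exact ⟨-n, by rw [zsmul_eq_mul, mul_one]; push_cast; linarith⟩

open DirichletCharacter

/-- Mean value of `|L(2,χ)|²` over Dirichlet characters mod `f` with `χ(-1) = 1`. -/
theorem mean_value_L_two_sq (f : ℕ) [NeZero f] (hf : 2 < f) :
    (2 / (Nat.totient f : ℝ)) *
      ∑ χ ∈ Finset.univ.filter (fun χ : DirichletCharacter ℂ f => χ (-1) = 1),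
        ‖χ.LFunction 2‖ ^ 2
    = (π ^ 4 / 90) * ((∏ p ∈ f.primeFactors, (1 - 1 / (p : ℝ) ^ 4)) + 10 * (∏ p ∈ f.primeFactors, (1 - 1 / (p : ℝ) ^ 2)) / (f : ℝ) ^ 2) := by
  have : Fact (1 < f) := ⟨by omega⟩
  have hf₀ : (f : ℂ) ≠ 0 := NeZero.ne _
  have hφ : (f.totient : ℂ) ≠ 0 := by
    exact_mod_cast (Nat.totient_pos.mpr (by omega)).ne'
  let E (k : ℕ) (a : ZMod f) : ℂ := hurwitzZetaEven (ZMod.toAddCircle a) k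
  have hE (k : ℕ) : (E k).Even := fun a ↦ by simp only [E, map_neg, hurwitzZetaEven_neg]
  have hone : (1 : DirichletCharacter ℂ f).Even := MulChar.one_apply isUnit_one.neg
  have hL (k : ℕ) (hk : k ≠ 1) (s : ℂ) (hs : s = riemannZeta k) :
      ∑ a, (1 : DirichletCharacter ℂ f) a * E k a
        = (f : ℂ) ^ k * ((∏ p ∈ f.primeFactors, (1 - 1 / (p : ℂ) ^ k)) * s) := by
    have h₁ := LFunction_natCast_of_even hone k
    have h₂ := LFunctionTrivChar_eq_mul_riemannZeta (N := f) (s := k) (by exact_mod_cast hk)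
    simp_rw [Complex.cpow_neg, Complex.cpow_natCast, ← one_div] at h₂
    rw [LFunctionTrivChar, h₁, ← hs] at h₂
    rw [← h₂]
    field_simp
    rfl
  have hL₂ := hL 2 (by decide) _ (by exact_mod_cast riemannZeta_two.symm)
  have hL₄ := hL 4 (by decide) _ (by exact_mod_cast riemannZeta_four.symm)
  have hsq (a : ZMod f) : (1 : DirichletCharacter ℂ f) a * (E 2 a * conj (E 2 a))
      = (1 : DirichletCharacter ℂ f) a * E 4 a / 2
        + π ^ 2 / 3 * ((1 : DirichletCharacter ℂ f) a * E 2 a) := by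
    by_cases ha : IsUnit a
    · have h := hurwitzZetaEven_two_mul_conj (int_add_val_div_ne_zero ha.ne_zero)
      rw [← ZMod.toAddCircle_apply] at h
      simp only [E, Nat.cast_ofNat, h]
      ring
    · simp [MulChar.map_nonunit _ ha]
  have hmean : ∑ χ ∈ Finset.univ.filter (fun χ : DirichletCharacter ℂ f => χ (-1) = 1),
      ((‖χ.LFunction 2‖ ^ 2 : ℝ) : ℂ) = ((f : ℂ) ^ 4)⁻¹ *
        (f.totient * ∑ a, (1 : DirichletCharacter ℂ f) a * (E 2 a * conj (E 2 a))) := by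
    rw [← sum_mul_conj_sum_apply_mul, Finset.mul_sum, Finset.sum_filter]
    refine Finset.sum_congr rfl fun χ _ ↦ ?_
    split_ifs with h
    · have h₂ := LFunction_natCast_of_even (χ := χ) h 2
      rw [Nat.cast_ofNat] at h₂
      push_cast
      rw [← Complex.mul_conj', h₂]
      simp only [map_mul, map_inv₀, map_pow, Complex.conj_natCast, E, Nat.cast_ofNat]
      ring
    · rw [sum_apply_mul_eq_zero_of_odd (χ.even_or_odd.resolve_left h) (hE 2)]
      simp
  simp_rw [hsq, Finset.sum_add_distrib, ← Finset.sum_div, ← Finset.mul_sum, hL₂, hL₄] at hmean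
  rw [← Complex.ofReal_inj]
  push_cast at hmean ⊢
  rw [hmean]
  field_simp
  ring
end

section
/- For every rational integer $f>2$, $\frac{2}{\phi(f)}\sum_{\chi\bmod f,\ \chi(-1)=-1}\vert L(3,\chi)\vert^2=\frac{\pi^6}{945}\left(\phi_6(f)-21\frac{\phi_2(f)}{f^4}\right)$, the sum being over the $\phi(f)/2$ odd Dirichlet characters modulo $f$. -/
open scoped Classical Real

open Finset ArithmeticFunction in
lemma sum_divisors_moebius_div_pow {n k : ℕ} (hn : n ≠ 0) (hk : k ≠ 0) :
    ∑ d ∈ n.divisors, (moebius d : ℝ) / (d : ℝ) ^ k =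
      ∏ p ∈ n.primeFactors, (1 - 1 / (p : ℝ) ^ k) := by
  let g : ArithmeticFunction ℝ := ⟨fun d ↦ ((d : ℝ) ^ k)⁻¹, by simp [hk]⟩
  have hg : g.IsMultiplicative := ⟨by simp [g], fun {m n} _ ↦ by simp [g, mul_pow, mul_comm]⟩
  let F : ArithmeticFunction ℝ := (pmul (moebius : ArithmeticFunction ℝ) g) * zeta
  have hF : F.IsMultiplicative :=
    (isMultiplicative_moebius.intCast.pmul hg).mul isMultiplicative_zeta.natCast
  have hFn (m : ℕ) : F m = ∑ d ∈ m.divisors, (moebius d : ℝ) / (d : ℝ) ^ k := by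
    simp only [F, coe_mul_zeta_apply, pmul_apply, div_eq_mul_inv]
    simp [g]
  rw [← hFn, hF.multiplicative_factorization _ hn, Finsupp.prod, Nat.support_factorization]
  refine prod_congr rfl fun p hp ↦ ?_
  have hpp := Nat.prime_of_mem_primeFactors hp
  obtain ⟨m, hm⟩ := Nat.exists_eq_succ_of_ne_zero
    (hpp.factorization_pos_of_dvd hn (Nat.dvd_of_mem_primeFactors hp)).ne'
  rw [hFn, hm, Nat.sum_divisors_prime_pow hpp, sum_range_succ', sum_range_succ', sum_eq_zero]
  · simp [moebius_apply_prime hpp]; ring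
  · intro i _
    rw [moebius_apply_prime_pow hpp (by lia)]
    simp

open ArithmeticFunction in
lemma sum_divisors_moebius (n : ℕ) :
    ∑ d ∈ n.divisors, (moebius d : ℝ) = if n = 1 then 1 else 0 := by
  have := congrArg (fun F : ArithmeticFunction ℤ ↦ F n) moebius_mul_coe_zeta
  simp only [coe_mul_zeta_apply, one_apply] at this
  exact_mod_cast this

namespace ZMod

lemma sum_eq_sum_range {M : Type*} [AddCommMonoid M] (n : ℕ) [NeZero n] (F : ZMod n → M) :
    ∑ j, F j = ∑ k ∈ Finset.range n, F k := by
  refine Finset.sum_nbij' ZMod.val (fun k ↦ (k : ZMod n)) ?_ ?_ ?_ ?_ ?_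
  · simp [ZMod.val_lt]
  · simp
  · simp
  · intro k hk; exact ZMod.val_cast_of_lt (by simpa using hk)
  · simp

open scoped ComplexConjugate FourierTransform in
/-- Parseval's identity for the discrete Fourier transform. -/
lemma sum_norm_sq_dft {n : ℕ} [NeZero n] (Φ : ZMod n → ℂ) :
    ∑ k, ‖dft Φ k‖ ^ 2 = n * ∑ j, ‖Φ j‖ ^ 2 := by
  have hconj (k : ZMod n) : conj (dft Φ k) = ∑ j, stdAddChar (j * k) * conj (Φ j) := by
    simp [dft_apply, AddChar.map_neg_eq_conj]
  have hdd (j : ZMod n) : ∑ k, stdAddChar (j * k) * dft Φ k = n * Φ j := by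
    have := congrFun (dft_dft Φ) (-j)
    simpa [dft_apply (dft Φ), mul_comm] using this
  apply Complex.ofReal_injective
  push_cast
  simp_rw [← Complex.mul_conj', hconj, Finset.mul_sum]
  rw [Finset.sum_comm]
  refine Finset.sum_congr rfl fun j _ ↦ ?_
  rw [← mul_assoc, ← hdd, Finset.sum_mul]
  exact Finset.sum_congr rfl fun k _ ↦ by ring

end ZMod

namespace DirichletCharacter

open scoped ComplexConjugate

lemma sum_char_mul_conj {n : ℕ} [NeZero n] (a b : ZMod n) :
    ∑ χ : DirichletCharacter ℂ n, χ a * conj (χ b) =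
      if IsUnit b ∧ a = b then (n.totient : ℂ) else 0 := by
  by_cases hb : IsUnit b
  · have h := sum_char_inv_mul_char_eq ℂ hb a
    simp only [hb, true_and, eq_comm (a := a), ← h]
    refine Finset.sum_congr rfl fun χ _ ↦ ?_
    obtain ⟨u, rfl⟩ := hb
    rw [mul_comm, starRingEnd_apply, ← MulChar.star_apply, MulChar.star_eq_inv,
      MulChar.inv_apply, Ring.inverse_unit, ZMod.inv_coe_unit]
  · simp [hb, MulChar.map_nonunit _ hb]

lemma sum_norm_sq_sum_mul {n : ℕ} [NeZero n] (g : ZMod n → ℂ) :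
    ∑ χ : DirichletCharacter ℂ n, ‖∑ j, χ j * g j‖ ^ 2 =
      n.totient * ∑ j, if IsUnit j then ‖g j‖ ^ 2 else 0 := by
  apply Complex.ofReal_injective
  push_cast
  simp_rw [← Complex.mul_conj', map_sum, map_mul, Finset.sum_mul_sum]
  rw [Finset.sum_comm, Finset.mul_sum]
  refine Finset.sum_congr rfl fun a _ ↦ ?_
  rw [Finset.sum_comm]
  trans ∑ b, (∑ χ : DirichletCharacter ℂ n, χ a * conj (χ b)) * (g a * conj (g b))
  · simp_rw [Finset.sum_mul]
    exact Finset.sum_congr rfl fun b _ ↦ Finset.sum_congr rfl fun χ _ ↦ by ring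
  · simp_rw [sum_char_mul_conj]
    rw [Finset.sum_eq_single a] <;> simp +contextual [eq_comm, Complex.mul_conj', apply_ite]

end DirichletCharacter

open ArithmeticFunction in
/-- Möbius inversion over the reduced fractions with denominator `n`. -/
lemma sum_coprime_range_div {n : ℕ} (hn : n ≠ 0) (h : ℝ → ℝ) :
    ∑ k ∈ Finset.range n, (if k.Coprime n then h (k / n) else 0) =
      ∑ d ∈ n.divisors, (moebius d : ℝ) *
        ∑ k ∈ Finset.range (n / d), h (k / (n / d : ℕ)) := by
  have key (d : ℕ) (hd : d ∈ n.divisors) : ∑ k ∈ Finset.range (n / d), h (k / (n / d : ℕ)) =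
      ∑ k ∈ Finset.range n, if d ∣ k then h (k / n) else 0 := by
    obtain ⟨e, rfl⟩ := Nat.dvd_of_mem_divisors hd
    have hd0 : d ≠ 0 := by rintro rfl; simp at hn
    have he0 : e ≠ 0 := by rintro rfl; simp at hn
    rw [Nat.mul_div_cancel_left _ (Nat.pos_of_ne_zero hd0), ← Finset.sum_filter]
    refine Finset.sum_nbij' (d * ·) (· / d) ?_ ?_ ?_ ?_ ?_
    · intro k hk
      simp only [Finset.mem_range, Finset.mem_filter, dvd_mul_right, and_true] at hk ⊢
      exact Nat.mul_lt_mul_of_pos_left hk (Nat.pos_of_ne_zero hd0)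
    · intro k hk
      simp at hk ⊢
      exact Nat.div_lt_of_lt_mul hk.1
    · intro k _
      exact Nat.mul_div_cancel_left _ (Nat.pos_of_ne_zero hd0)
    · intro k hk
      simp at hk
      exact Nat.mul_div_cancel' hk.2
    · intro k _
      congr 1
      push_cast
      field_simp
  symm
  rw [Finset.sum_congr rfl fun d hd ↦ by rw [key d hd, Finset.mul_sum], Finset.sum_comm]
  refine Finset.sum_congr rfl fun k _ ↦ ?_
  have hdiv : n.divisors.filter (· ∣ k) = (k.gcd n).divisors := by
    ext d
    simp [Nat.dvd_gcd_iff, hn, and_comm]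
  simp_rw [mul_ite, mul_zero]
  rw [← Finset.sum_filter, hdiv, ← Finset.sum_mul, sum_divisors_moebius]
  simp [Nat.Coprime]

section SpecialValues

open Complex HurwitzZeta


lemma sinZeta_three {x : ℝ} (hx : x ∈ Set.Icc (0:ℝ) 1) :
    sinZeta x 3 = ((2 * π ^ 3 / 3 * (x ^ 3 - 3 / 2 * x ^ 2 + x / 2) : ℝ) : ℂ) := by
  have h := sinZeta_two_mul_nat_add_one (k := 1) one_ne_zero hx
  have e : (2 * ((1:ℕ):ℂ) + 1) = 3 := by norm_num
  rw [e] at h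
  rw [h, Polynomial.bernoulli_def]
  simp [Finset.sum_range_succ, bernoulli_one, bernoulli_eq_bernoulli'_of_ne_one, bernoulli'_three, Nat.factorial, Nat.choose]
  ring

lemma sum_range_bernoulli_sq {n : ℕ} (hn : n ≠ 0) :
    ∑ k ∈ Finset.range n, (((k : ℝ) / n) ^ 3 - 3 / 2 * ((k : ℝ) / n) ^ 2 + (k : ℝ) / n / 2) ^ 2 =
      ((n : ℝ) ^ 6 - 21 * n ^ 2 + 20) / (840 * n ^ 5) := by
  have key (x : ℝ) (m : ℕ) :
      ∑ k ∈ Finset.range m, (k * (k - x) * (2 * k - x)) ^ 2 =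
      (m : ℝ) * (m - 1) * (2 * m - 1) * (3 * m ^ 4 - 6 * m ^ 3 + 3 * m + 1) / 42 * 4
      - 12 * x * (m ^ 2 * (m - 1) ^ 2 * (2 * m ^ 2 - 2 * m - 1) / 12)
      + 13 * x ^ 2 * (m * (m - 1) * (2 * m - 1) * (3 * m ^ 2 - 3 * m - 1) / 30)
      - 6 * x ^ 3 * (m ^ 2 * (m - 1) ^ 2 / 4) + x ^ 4 * (m * (m - 1) * (2 * m - 1) / 6) := by
    induction m with
    | zero => simp
    | succ m ih => rw [Finset.sum_range_succ, ih]; push_cast; ring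
  have hn' : (n : ℝ) ≠ 0 := by exact_mod_cast hn
  trans (∑ k ∈ Finset.range n, ((k : ℝ) * (k - n) * (2 * k - n)) ^ 2) / (4 * n ^ 6)
  · rw [Finset.sum_div]
    refine Finset.sum_congr rfl fun k _ ↦ ?_
    field_simp
    ring
  · rw [key]
    field_simp
    ring

namespace ZMod

lemma dft_hurwitzZetaOdd {n : ℕ} [NeZero n] (s : ℂ) (hs : s ≠ 1) (k : ZMod n) :
    dft (fun j : ZMod n ↦ hurwitzZetaOdd (toAddCircle j) s) k =
      n ^ s * (-Complex.I * sinZeta (toAddCircle k) s) := by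
  have hn : (n : ℂ) ≠ 0 := by exact_mod_cast NeZero.ne n
  have h1 : (n : ℂ) ^ s * (n : ℂ) ^ (-s) = 1 := by rw [← Complex.cpow_add _ _ hn]; simp
  have h (l : ZMod n) := LFunction_stdAddChar_eq_expZeta l s (.inr hs)
  let Ψ : ZMod n → ℂ := fun j ↦ stdAddChar (-k * j) - stdAddChar (k * j)
  have hΨ : Ψ.Odd := fun j ↦ by simp [Ψ]
  have h2 := LFunction_def_odd hΨ s
  have h3 : LFunction Ψ s = -2 * Complex.I * sinZeta (toAddCircle k) s := by
    have : LFunction Ψ s = expZeta (toAddCircle (-k)) s - expZeta (toAddCircle k) s := by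
      rw [← h k, ← h (-k)]
      simp only [LFunction, Ψ, sub_mul, Finset.sum_sub_distrib, mul_sub]
    rw [this, expZeta, expZeta, map_neg, cosZeta_neg, sinZeta_neg]
    ring
  have h4 : ∑ j, Ψ j * hurwitzZetaOdd (toAddCircle j) s =
      2 * dft (fun j : ZMod n ↦ hurwitzZetaOdd (toAddCircle j) s) k := by
    have h5 : ∑ j, stdAddChar (k * j) * hurwitzZetaOdd (toAddCircle j) s =
        - ∑ j, stdAddChar (-k * j) * hurwitzZetaOdd (toAddCircle j) s := by
      rw [← Finset.sum_neg_distrib]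
      exact Fintype.sum_equiv (.neg _) _ _ fun j ↦ by simp [hurwitzZetaOdd_neg]
    simp only [Ψ, sub_mul, Finset.sum_sub_distrib, h5, dft_apply, smul_eq_mul]
    simp only [mul_comm _ k, neg_mul]
    ring
  rw [h3, h4] at h2
  linear_combination (-1 / 2 : ℂ) * (n : ℂ) ^ s * h2 -
    dft (fun j : ZMod n ↦ hurwitzZetaOdd (toAddCircle j) s) k * h1

end ZMod

lemma norm_sinZeta_three_sq {n : ℕ} [NeZero n] {k : ℕ} (hk : k < n) :
    ‖sinZeta (ZMod.toAddCircle (k : ZMod n)) 3‖ ^ 2 = 4 * π ^ 6 / 9 *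
      (((k : ℝ) / n) ^ 3 - 3 / 2 * ((k : ℝ) / n) ^ 2 + (k : ℝ) / n / 2) ^ 2 := by
  have hn : (0 : ℝ) < n := by exact_mod_cast NeZero.pos n
  rw [ZMod.toAddCircle_natCast, sinZeta_three 
    ⟨by positivity, (div_le_one hn).2 (by exact_mod_cast hk.le)⟩, norm_real, Real.norm_eq_abs, sq_abs]
  ring

lemma sum_norm_sq_hurwitzZetaOdd_three {n : ℕ} (hn : n ≠ 0) :
    ∑ k ∈ Finset.range n, ‖hurwitzZetaOdd ((k / n : ℝ) : UnitAddCircle) 3‖ ^ 2 =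
      π ^ 6 / 1890 * ((n : ℝ) ^ 6 - 21 * n ^ 2 + 20) := by
  have : NeZero n := ⟨hn⟩
  have hn' : (n : ℝ) ≠ 0 := by exact_mod_cast hn
  have h := ZMod.sum_norm_sq_dft fun j : ZMod n ↦ hurwitzZetaOdd (ZMod.toAddCircle j) 3
  simp_rw [ZMod.dft_hurwitzZetaOdd (n := n) 3 (by norm_num)] at h
  rw [ZMod.sum_eq_sum_range, ZMod.sum_eq_sum_range] at h
  simp_rw [← ZMod.toAddCircle_natCast]
  have h1 : ∀ k ∈ Finset.range n,
      ‖(n : ℂ) ^ (3 : ℂ) * (-I * sinZeta (ZMod.toAddCircle (k : ZMod n)) 3)‖ ^ 2 = n ^ 6 * (4 * π ^ 6 / 9) *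
      (((k : ℝ) / n) ^ 3 - 3 / 2 * ((k : ℝ) / n) ^ 2 + (k : ℝ) / n / 2) ^ 2 := by
    intro k hk
    rw [norm_mul, norm_mul, norm_neg, norm_I, one_mul, mul_pow,
      norm_sinZeta_three_sq (Finset.mem_range.1 hk), show (3 : ℂ) = ((3 : ℕ) : ℂ) by norm_num,
      cpow_natCast, norm_pow, norm_natCast]
    ring
  rw [Finset.sum_congr rfl h1, ← Finset.mul_sum, sum_range_bernoulli_sq hn] at h
  apply mul_left_cancel₀ hn'
  rw [← h]
  field_simp
  ring

lemma DirichletCharacter.sum_odd_norm_sq_LFunction {n : ℕ} [NeZero n] :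
    ∑ χ ∈ Finset.univ.filter (fun χ : DirichletCharacter ℂ n => χ (-1) = (-1)),
        ‖χ.LFunction 3‖ ^ 2 = n.totient / (n : ℝ) ^ 6 * ∑ j : ZMod n,
          if IsUnit j then ‖hurwitzZetaOdd (ZMod.toAddCircle j) 3‖ ^ 2 else 0 := by
  rw [div_mul_eq_mul_div, ← sum_norm_sq_sum_mul, Finset.sum_div, Finset.sum_filter]
  refine Finset.sum_congr rfl fun χ _ ↦ ?_
  split_ifs with hχ
  · rw [LFunction, ZMod.LFunction_def_odd (Odd.to_fun hχ), norm_mul, mul_pow,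
      show (-3 : ℂ) = -((3 : ℕ) : ℂ) by norm_num, cpow_neg, cpow_natCast, norm_inv, norm_pow, norm_natCast]
    field_simp
  · have he : χ.Even := χ.even_or_odd.resolve_right hχ
    have hH : (fun j : ZMod n ↦ hurwitzZetaOdd (ZMod.toAddCircle j) 3).Odd := fun j ↦ by
      simp [hurwitzZetaOdd_neg]
    have h0 : ∑ j, χ j * hurwitzZetaOdd (ZMod.toAddCircle j) 3 = 0 :=
      (he.to_fun.mul_odd hH).sum_eq_zero
    simp [h0]

lemma sum_isUnit_norm_sq_hurwitzZetaOdd_three {n : ℕ} [NeZero n] :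
    (∑ j : ZMod n, if IsUnit j then ‖hurwitzZetaOdd (ZMod.toAddCircle j) 3‖ ^ 2 else 0) =
      π ^ 6 / 1890 * (n ^ 6 * ∏ p ∈ n.primeFactors, (1 - 1 / (p : ℝ) ^ 6)
        - 21 * n ^ 2 * ∏ p ∈ n.primeFactors, (1 - 1 / (p : ℝ) ^ 2) + if n = 1 then 20 else 0) := by
  have hn := NeZero.ne n
  rw [ZMod.sum_eq_sum_range]
  simp_rw [ZMod.isUnit_iff_coprime, ZMod.toAddCircle_natCast]
  rw [sum_coprime_range_div hn fun x ↦ ‖hurwitzZetaOdd (x : UnitAddCircle) 3‖ ^ 2,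
    ← sum_divisors_moebius_div_pow hn (by norm_num), ← sum_divisors_moebius_div_pow hn (by norm_num),
    show (if n = 1 then (20 : ℝ) else 0) = 20 * if n = 1 then 1 else 0 by simp,
    ← sum_divisors_moebius]
  simp_rw [Finset.mul_sum, ← Finset.sum_sub_distrib, ← Finset.sum_add_distrib, Finset.mul_sum]
  refine Finset.sum_congr rfl fun d hd ↦ ?_
  obtain ⟨e, rfl⟩ := Nat.dvd_of_mem_divisors hd
  obtain ⟨hd0, he0⟩ := mul_ne_zero_iff.1 hn
  rw [← Finset.mul_sum, Nat.mul_div_cancel_left _ (Nat.pos_of_ne_zero hd0),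
    sum_norm_sq_hurwitzZetaOdd_three he0]
  push_cast
  field_simp

end SpecialValues

/-- Mean value of `|L(3,χ)|²` over Dirichlet characters mod `f` with `χ(-1) = (-1)`. -/
theorem mean_value_L_three_sq (f : ℕ) [NeZero f] (hf : 2 < f) :
    (2 / (Nat.totient f : ℝ)) *
      ∑ χ ∈ Finset.univ.filter (fun χ : DirichletCharacter ℂ f => χ (-1) = (-1)),
        ‖χ.LFunction 3‖ ^ 2
    = (π ^ 6 / 945) * ((∏ p ∈ f.primeFactors, (1 - 1 / (p : ℝ) ^ 6)) - 21 * (∏ p ∈ f.primeFactors, (1 - 1 / (p : ℝ) ^ 2)) / (f : ℝ) ^ 4) := by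
  have hf0 : (f : ℝ) ≠ 0 := by exact_mod_cast NeZero.ne f
  have ht : (f.totient : ℝ) ≠ 0 := by exact_mod_cast (Nat.totient_pos.2 (NeZero.pos f)).ne'
  rw [DirichletCharacter.sum_odd_norm_sq_LFunction, sum_isUnit_norm_sq_hurwitzZetaOdd_three,
    if_neg (by lia)]
  field_simp
  ring
end

section
/- For every rational integer $f>2$, $\frac{2}{\phi(f)}\sum_{\chi\bmod f,\ \chi(-1)=-1}\vert L(5,\chi)\vert^2=\frac{\pi^{10}}{93555}\left(\phi_{10}(f)-22\frac{\phi_4(f)}{f^6}-231\frac{\phi_2(f)}{f^8}\right)$, the sum being over the $\phi(f)/2$ odd Dirichlet characters modulo $f$. -/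
open scoped Classical Real

section

open ZMod HurwitzZeta Finset

/-- The Jordan totient `J_k`, in product form. -/
noncomputable def jordanTotient (k n : ℕ) : ℝ :=
  (n : ℝ) ^ k * ∏ p ∈ n.primeFactors, (1 - 1 / (p : ℝ) ^ k)

lemma jordanTotient_mul_of_coprime (k : ℕ) {m n : ℕ} (h : m.Coprime n) :
    jordanTotient k (m * n) = jordanTotient k m * jordanTotient k n := by
  simp only [jordanTotient, h.primeFactors_mul, prod_union h.disjoint_primeFactors]
  push_cast
  ring

lemma jordanTotient_prime_pow_succ (k i : ℕ) {p : ℕ} (hp : p.Prime) :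
    jordanTotient k (p ^ (i + 1)) = ((p ^ (i + 1) : ℕ) : ℝ) ^ k - ((p ^ i : ℕ) : ℝ) ^ k := by
  have hp0 : (p : ℝ) ≠ 0 := by exact_mod_cast hp.ne_zero
  rw [jordanTotient, Nat.primeFactors_prime_pow i.succ_ne_zero hp]
  simp only [prod_singleton]
  push_cast
  field_simp
  rw [pow_succ (p : ℝ) i, mul_pow]
  ring

lemma sum_divisors_jordanTotient {k n : ℕ} (hk : k ≠ 0) :
    ∑ d ∈ n.divisors, jordanTotient k d = (n : ℝ) ^ k := by
  let J : ArithmeticFunction ℝ := ⟨jordanTotient k, by simp [jordanTotient, hk]⟩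
  have hJ : J.IsMultiplicative :=
    ⟨by simp [J, jordanTotient], fun h ↦ jordanTotient_mul_of_coprime k h⟩
  let P : ArithmeticFunction ℝ := ⟨fun n ↦ (n : ℝ) ^ k, by simp [hk]⟩
  have hP : P.IsMultiplicative := ⟨by simp [P], fun _ ↦ by simp [P, mul_pow]⟩
  have h : J * (ArithmeticFunction.zeta : ArithmeticFunction ℝ) = P := by
    rw [ArithmeticFunction.IsMultiplicative.eq_iff_eq_on_prime_powers _
      (hJ.mul ArithmeticFunction.isMultiplicative_zeta.natCast) _ hP]
    intro p i hp
    rw [ArithmeticFunction.coe_mul_zeta_apply, Nat.sum_divisors_prime_pow hp]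
    change ∑ x ∈ range (i + 1), jordanTotient k (p ^ x) = ((p ^ i : ℕ) : ℝ) ^ k
    induction i with
    | zero => simp [jordanTotient]
    | succ i ih => rw [sum_range_succ, ih, jordanTotient_prime_pow_succ k i hp]; ring
  have := congrArg (fun F : ArithmeticFunction ℝ ↦ F n) h
  rwa [ArithmeticFunction.coe_mul_zeta_apply] at this

/-- A sum over all fractions `a / N` is regrouped by reduced denominators. -/
lemma sum_range_div_eq_sum_divisors {M : Type*} [AddCommMonoid M] (F : ℝ → M) {N : ℕ}
    (hN : 0 < N) :
    ∑ a ∈ range N, F (a / N) =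
      ∑ d ∈ N.divisors, ∑ b ∈ (range d).filter (Nat.Coprime d), F (b / d) := by
  rw [← Nat.sum_div_divisors, ← sum_fiberwise_of_maps_to (g := N.gcd) (t := N.divisors)
    fun a _ ↦ Nat.mem_divisors.mpr ⟨Nat.gcd_dvd_left _ _, hN.ne'⟩]
  refine sum_congr rfl fun d hd ↦ ?_
  obtain ⟨x, rfl⟩ := Nat.dvd_of_mem_divisors hd
  have hd0 : 0 < d := Nat.pos_of_mul_pos_right hN
  rw [Nat.mul_div_cancel_left x hd0]
  symm
  refine sum_bij (fun b _ ↦ d * b) ?_ ?_ ?_ ?_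
  · simp only [mem_filter, mem_range, and_imp, Nat.Coprime]
    intro a ha1 ha2
    exact ⟨by gcongr, by rw [Nat.gcd_mul_left, ha2, mul_one]⟩
  · intro a _ b _ h
    exact Nat.eq_of_mul_eq_mul_left hd0 h
  · simp only [mem_filter, mem_range, and_imp]
    intro b hb hg
    obtain ⟨c, rfl⟩ : d ∣ b := hg ▸ Nat.gcd_dvd_right _ _
    refine ⟨c, ⟨Nat.lt_of_mul_lt_mul_left hb, ?_⟩, rfl⟩
    rw [Nat.gcd_mul_left] at hg
    exact Nat.eq_of_mul_eq_mul_left hd0 (by simpa using hg)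
  · intro b _
    have : (d : ℝ) ≠ 0 := by exact_mod_cast hd0.ne'
    push_cast
    rw [mul_div_mul_left _ _ this]

lemma bernoulli_five_eval (x : ℂ) :
    ((Polynomial.bernoulli 5).map (algebraMap ℚ ℂ)).eval x
      = x ^ 5 - 5 / 2 * x ^ 4 + 5 / 3 * x ^ 3 - x / 6 := by
  have h2 : bernoulli 2 = 1 / 6 := by rw [bernoulli_eq_bernoulli'_of_ne_one (by norm_num)]; simp
  have h3 : bernoulli 3 = 0 := by rw [bernoulli_eq_bernoulli'_of_ne_one (by norm_num)]; simp
  have h4 : bernoulli 4 = -1 / 30 := by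
    rw [bernoulli_eq_bernoulli'_of_ne_one (by norm_num)]; simp
  have h5 : bernoulli 5 = 0 := bernoulli_eq_zero_of_odd (by decide) (by norm_num)
  rw [Polynomial.bernoulli_def]
  simp only [sum_range_succ, range_zero, sum_empty, h2, h3, h4, h5]
  norm_num [Nat.choose, Polynomial.eval_monomial]
  ring

lemma sum_range_bernoulli_five_sq {N : ℕ} (hN : 0 < N) :
    ∑ a ∈ range N, ((a / N : ℝ) ^ 5 - 5 / 2 * (a / N : ℝ) ^ 4 + 5 / 3 * (a / N : ℝ) ^ 3
        - (a / N : ℝ) / 6) ^ 2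
      = 5 / 16632 * ((N : ℝ) ^ 10 - 22 * (N : ℝ) ^ 4 - 231 * (N : ℝ) ^ 2 + 252) / (N : ℝ) ^ 9 := by
  have key (n : ℕ) (c : ℝ) :
      ∑ a ∈ range n, ((a : ℝ) ^ 5 - 5 / 2 * c * (a : ℝ) ^ 4 + 5 / 3 * c ^ 2 * (a : ℝ) ^ 3
        - c ^ 4 / 6 * a) ^ 2 =
        (n ^ 11 / 11 - n ^ 10 / 2 + 5 / 6 * n ^ 9 - n ^ 7 + n ^ 5 - n ^ 3 / 2 + 5 / 66 * n)
        + c * (-n ^ 10 / 2 + 5 / 2 * n ^ 9 - 15 / 4 * n ^ 8 + 7 / 2 * n ^ 6 - 5 / 2 * n ^ 4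
          + 3 / 4 * n ^ 2)
        + c ^ 2 * (115 / 108 * n ^ 9 - 115 / 24 * n ^ 8 + 115 / 18 * n ^ 7 - 161 / 36 * n ^ 5
          + 115 / 54 * n ^ 3 - 23 / 72 * n)
        + c ^ 3 * (-25 / 24 * n ^ 8 + 25 / 6 * n ^ 7 - 175 / 36 * n ^ 6 + 175 / 72 * n ^ 4
          - 25 / 36 * n ^ 2)
        + c ^ 4 * (22 / 63 * n ^ 7 - 11 / 9 * n ^ 6 + 11 / 9 * n ^ 5 - 11 / 27 * n ^ 3
          + 11 / 189 * n)
        + c ^ 5 * (5 / 36 * n ^ 6 - 5 / 12 * n ^ 5 + 25 / 72 * n ^ 4 - 5 / 72 * n ^ 2)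
        + c ^ 6 * (-n ^ 5 / 9 + 5 / 18 * n ^ 4 - 5 / 27 * n ^ 3 + n / 54)
        + c ^ 8 * (n ^ 3 / 108 - n ^ 2 / 72 + n / 216) := by
    induction n with
    | zero => simp
    | succ n ih => rw [sum_range_succ, ih]; push_cast; ring
  have hN0 : (N : ℝ) ≠ 0 := by exact_mod_cast hN.ne'
  have scale (a : ℕ) : ((a / N : ℝ) ^ 5 - 5 / 2 * (a / N : ℝ) ^ 4 + 5 / 3 * (a / N : ℝ) ^ 3
        - (a / N : ℝ) / 6) ^ 2 = ((a : ℝ) ^ 5 - 5 / 2 * N * (a : ℝ) ^ 4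
        + 5 / 3 * N ^ 2 * (a : ℝ) ^ 3 - N ^ 4 / 6 * a) ^ 2 / N ^ 10 := by
    field_simp
  simp only [scale, ← sum_div, key N N]
  field_simp
  ring

/-- The value of `sinZeta` at `5` in terms of the fifth Bernoulli polynomial. -/
lemma sinZeta_toAddCircle_five {N : ℕ} [NeZero N] (j : ZMod N) :
    sinZeta (toAddCircle j) 5 = ((-(2 * π) ^ 5 / 240 * ((j.val / N : ℝ) ^ 5
      - 5 / 2 * (j.val / N : ℝ) ^ 4 + 5 / 3 * (j.val / N : ℝ) ^ 3 - (j.val / N : ℝ) / 6) : ℝ) : ℂ)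
    := by
  have hx : (j.val / N : ℝ) ∈ Set.Icc 0 1 := Set.mem_Icc.mpr ⟨by positivity,
    (div_le_one (Nat.cast_pos.mpr <| NeZero.pos _)).mpr <| Nat.cast_le.mpr (val_lt j).le⟩
  have h := sinZeta_two_mul_nat_add_one (k := 2) (by norm_num) hx
  rw [show 2 * 2 + 1 = 5 from rfl, bernoulli_five_eval, Nat.cast_ofNat,
    show (2 * 2 + 1 : ℂ) = 5 by norm_num] at h
  rw [toAddCircle_apply, h]
  push_cast [show Nat.factorial 5 = 120 from rfl]
  ring

lemma sum_dft_mul {N : ℕ} [NeZero N] (Φ Ψ : ZMod N → ℂ) :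
    ∑ j, 𝓕 Φ j * Ψ j = ∑ j, Φ j * 𝓕 Ψ j := by
  simp only [dft_apply, smul_eq_mul, sum_mul, mul_sum]
  rw [sum_comm]
  refine sum_congr rfl fun i _ ↦ sum_congr rfl fun j _ ↦ ?_
  rw [mul_comm j i]
  ring

/-- Parseval's identity for the discrete Fourier transform. -/
lemma sum_norm_dft_sq {N : ℕ} [NeZero N] (Φ : ZMod N → ℂ) :
    ∑ j, ‖𝓕 Φ j‖ ^ 2 = N * ∑ j, ‖Φ j‖ ^ 2 := by
  have hconj (j : ZMod N) : (starRingEnd ℂ) (𝓕 Φ j) = 𝓕 (fun i ↦ (starRingEnd ℂ) (Φ (-i))) j := by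
    rw [dft_comp_neg fun i ↦ (starRingEnd ℂ) (Φ i)]
    simp only [dft_apply, smul_eq_mul, map_sum, map_mul, ← AddChar.map_neg_eq_conj, mul_neg]
  have h := sum_dft_mul Φ (𝓕 fun i ↦ (starRingEnd ℂ) (Φ (-i)))
  simp only [← hconj, dft_dft, neg_neg, smul_eq_mul, mul_left_comm _ (N : ℂ), ← mul_sum,
    Complex.mul_conj'] at h
  exact_mod_cast h

lemma dft_hurwitzZetaOdd {N : ℕ} [NeZero N] {s : ℂ} (hs : s ≠ 1) (j : ZMod N) :
    𝓕 (fun a : ZMod N ↦ hurwitzZetaOdd (toAddCircle a) s) j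
      = -(N : ℂ) ^ s * Complex.I * sinZeta (toAddCircle j) s := by
  set G : ZMod N → ℂ := fun a ↦ hurwitzZetaOdd (toAddCircle a) s with hG
  have hGodd : Function.Odd (𝓕 G) := dft_odd_iff.mpr fun a ↦ by
    simp [hG, map_neg, hurwitzZetaOdd_neg]
  have hN : (N : ℂ) ≠ 0 := NeZero.ne _
  have key {Φ : ZMod N → ℂ} (hΦ : Φ.Odd) :
      ∑ j, Φ j * (𝓕 G j + (N : ℂ) ^ s * Complex.I * sinZeta (toAddCircle j) s) = 0 := by
    have h1 := LFunction_def_odd (dft_odd_iff.mpr hΦ) s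
    rw [LFunction_dft Φ (.inr hs), sum_dft_mul Φ G] at h1
    have h2 : ∑ j, Φ j * expZeta (toAddCircle (-j)) s
        = -(Complex.I * ∑ j, Φ j * sinZeta (toAddCircle j) s) := by
      have h3 : ∑ j, Φ j * cosZeta (toAddCircle j) s = 0 :=
        (hΦ.mul_even fun j ↦ by simp [cosZeta_neg]).sum_eq_zero
      simp only [expZeta, map_neg, cosZeta_neg, sinZeta_neg, mul_add, sum_add_distrib, h3,
        zero_add, mul_sum, ← sum_neg_distrib]
      exact sum_congr rfl fun _ _ ↦ by ring
    have h4 : (N : ℂ) ^ s * (N : ℂ) ^ (-s) = 1 := by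
      rw [← Complex.cpow_add _ _ hN, add_neg_cancel, Complex.cpow_zero]
    rw [h2] at h1
    have h5 := congrArg ((N : ℂ) ^ s * ·) h1
    simp only [← mul_assoc, h4, one_mul] at h5
    have h6 : ∑ j, Φ j * 𝓕 G j = -((N : ℂ) ^ s * Complex.I *
        ∑ j, Φ j * sinZeta (toAddCircle j) s) := by
      linear_combination -h5
    simp only [mul_add, sum_add_distrib, mul_left_comm _ ((N : ℂ) ^ s * Complex.I), ← mul_sum, h6,
      neg_add_cancel]
  have h := key (Φ := fun j ↦ (starRingEnd ℂ)
    (𝓕 G j + (N : ℂ) ^ s * Complex.I * sinZeta (toAddCircle j) s)) fun j ↦ by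
      simp only [hGodd j, map_neg, sinZeta_neg, mul_neg, ← neg_add]
  simp only [← Complex.normSq_eq_conj_mul_self] at h
  norm_cast at h
  rw [sum_eq_zero_iff_of_nonneg fun _ _ ↦ Complex.normSq_nonneg _] at h
  have := Complex.normSq_eq_zero.mp (h j (mem_univ j))
  linear_combination this

lemma sum_univ_eq_sum_range_val {M : Type*} [AddCommMonoid M] {N : ℕ} [NeZero N] (F : ℕ → M) :
    ∑ j : ZMod N, F j.val = ∑ a ∈ range N, F a := by
  refine sum_nbij' ZMod.val (fun a ↦ (a : ZMod N)) ?_ ?_ ?_ ?_ ?_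
  · simp [ZMod.val_lt]
  · simp
  · simp
  · intro a ha
    exact ZMod.val_cast_of_lt (mem_range.mp ha)
  · simp

lemma sum_norm_hurwitzZetaOdd_five_sq {N : ℕ} (hN : 0 < N) :
    ∑ a ∈ range N, ‖hurwitzZetaOdd ((a / N : ℝ) : UnitAddCircle) 5‖ ^ 2
      = π ^ 10 / 187110 * ((N : ℝ) ^ 10 - 22 * (N : ℝ) ^ 4 - 231 * (N : ℝ) ^ 2 + 252) := by
  have : NeZero N := ⟨hN.ne'⟩
  have hN0 : (N : ℝ) ≠ 0 := by exact_mod_cast hN.ne'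
  have h := sum_norm_dft_sq fun a : ZMod N ↦ hurwitzZetaOdd (toAddCircle a) 5
  have hs : (5 : ℂ) ≠ 1 := by norm_num
  have hpow : ‖(N : ℂ) ^ (5 : ℂ)‖ = (N : ℝ) ^ 5 := by
    rw [show (5 : ℂ) = ((5 : ℕ) : ℂ) by norm_num, Complex.cpow_natCast, norm_pow,
      Complex.norm_natCast]
  simp only [dft_hurwitzZetaOdd hs, sinZeta_toAddCircle_five, norm_mul, norm_neg, Complex.norm_I,
    hpow, Complex.norm_real, Real.norm_eq_abs, mul_pow, sq_abs, mul_one, ← mul_sum] at h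
  rw [sum_univ_eq_sum_range_val fun a ↦ ((a / N : ℝ) ^ 5 - 5 / 2 * (a / N : ℝ) ^ 4
    + 5 / 3 * (a / N : ℝ) ^ 3 - (a / N : ℝ) / 6) ^ 2, sum_range_bernoulli_five_sq hN] at h
  simp only [toAddCircle_apply] at h
  rw [sum_univ_eq_sum_range_val fun a ↦
    ‖hurwitzZetaOdd ((a / N : ℝ) : UnitAddCircle) 5‖ ^ 2] at h
  refine mul_left_cancel₀ hN0 (h.symm.trans ?_)
  field_simp
  ring

lemma sum_coprime_norm_hurwitzZetaOdd_five_sq {N : ℕ} (hN : 1 < N) :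
    ∑ a ∈ (range N).filter (Nat.Coprime N), ‖hurwitzZetaOdd ((a / N : ℝ) : UnitAddCircle) 5‖ ^ 2
      = π ^ 10 / 187110 *
        (jordanTotient 10 N - 22 * jordanTotient 4 N - 231 * jordanTotient 2 N) := by
  set G : ℝ → ℝ := fun x ↦ ‖hurwitzZetaOdd (x : UnitAddCircle) 5‖ ^ 2
  let U (d : ℕ) : ℝ := ∑ b ∈ (range d).filter (Nat.Coprime d), G (b / d)
  let V (d : ℕ) : ℝ := π ^ 10 / 187110 * (jordanTotient 10 d - 22 * jordanTotient 4 d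
    - 231 * jordanTotient 2 d + if d = 1 then 252 else 0)
  have hU : ∀ n > 0, ∑ d ∈ n.divisors, U d = ∑ a ∈ range n, G (a / n) := fun n hn ↦
    (sum_range_div_eq_sum_divisors G hn).symm
  have hV : ∀ n > 0, ∑ d ∈ n.divisors, V d = ∑ a ∈ range n, G (a / n) := fun n hn ↦ by
    rw [sum_norm_hurwitzZetaOdd_five_sq hn]
    simp [V, ← mul_sum, sum_add_distrib, sum_sub_distrib, sum_divisors_jordanTotient, hn.ne']
  have hU' := ArithmeticFunction.sum_eq_iff_sum_mul_moebius_eq.mp hU N (by lia)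
  have hV' := ArithmeticFunction.sum_eq_iff_sum_mul_moebius_eq.mp hV N (by lia)
  have h : U N = V N := hU'.symm.trans hV'
  simpa [U, V, G, hN.ne'] using h

/-- The mean square of a character sum over all Dirichlet characters. -/
lemma sum_norm_sum_dirichletCharacter_sq {N : ℕ} [NeZero N] (G : ZMod N → ℂ) :
    ∑ χ : DirichletCharacter ℂ N, ‖∑ a, χ a * G a‖ ^ 2
      = N.totient * ∑ a ∈ univ.filter (fun a : ZMod N ↦ IsUnit a), ‖G a‖ ^ 2 := by
  have hconj (χ : DirichletCharacter ℂ N) {a : ZMod N} (ha : IsUnit a) :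
      (starRingEnd ℂ) (χ a) = χ a⁻¹ := by
    obtain ⟨u, rfl⟩ := ha
    rw [← Complex.inv_eq_conj (χ.unit_norm_eq_one u)]
    refine inv_eq_of_mul_eq_one_right ?_
    rw [← map_mul, ZMod.mul_inv_of_unit _ u.isUnit, map_one]
  have h : ∑ χ : DirichletCharacter ℂ N,
      (starRingEnd ℂ) (∑ a, χ a * G a) * ∑ a, χ a * G a
      = N.totient * ∑ a ∈ univ.filter (fun a : ZMod N ↦ IsUnit a),
        (starRingEnd ℂ) (G a) * G a := by
    simp only [map_sum, map_mul, sum_mul_sum]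
    rw [sum_comm, mul_sum, sum_filter]
    refine sum_congr rfl fun a _ ↦ ?_
    rw [sum_comm]
    split_ifs with ha
    · have hsum (b : ZMod N) : ∑ χ : DirichletCharacter ℂ N,
          (starRingEnd ℂ) (χ a) * (starRingEnd ℂ) (G a) * (χ b * G b)
          = if a = b then N.totient * ((starRingEnd ℂ) (G a) * G b) else 0 := by
        rw [← ite_zero_mul, ← DirichletCharacter.sum_char_inv_mul_char_eq ℂ ha, sum_mul]
        exact sum_congr rfl fun χ _ ↦ by rw [hconj χ ha]; ring
      simp only [hsum, sum_ite_eq, mem_univ, if_true]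
    · simp [MulChar.map_nonunit _ ha]
  simp only [Complex.conj_mul'] at h
  exact_mod_cast h

/-- The sum of `|L(5,χ)|²` over odd characters as a sum over reduced fractions. -/
lemma sum_odd_norm_LFunction_five_sq (N : ℕ) [NeZero N] :
    ∑ χ ∈ univ.filter (fun χ : DirichletCharacter ℂ N ↦ χ (-1) = -1), ‖χ.LFunction 5‖ ^ 2
      = N.totient / (N : ℝ) ^ 10 * ∑ a ∈ (range N).filter (Nat.Coprime N),
        ‖hurwitzZetaOdd ((a / N : ℝ) : UnitAddCircle) 5‖ ^ 2 := by
  set G : ZMod N → ℂ := fun a ↦ hurwitzZetaOdd (toAddCircle a) 5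
  have hN : (N : ℝ) ≠ 0 := NeZero.ne _
  have hpow : ‖(N : ℂ) ^ (-5 : ℂ)‖ ^ 2 = ((N : ℝ) ^ 10)⁻¹ := by
    rw [Complex.cpow_neg, show (5 : ℂ) = ((5 : ℕ) : ℂ) by norm_num, Complex.cpow_natCast, norm_inv,
      norm_pow, Complex.norm_natCast, inv_pow, ← pow_mul]
  have hodd (χ : DirichletCharacter ℂ N) (hχ : χ.Odd) :
      ‖χ.LFunction 5‖ ^ 2 = ((N : ℝ) ^ 10)⁻¹ * ‖∑ a, χ a * G a‖ ^ 2 := by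
    rw [DirichletCharacter.LFunction, LFunction_def_odd hχ.to_fun, norm_mul, mul_pow, hpow]
  have heven (χ : DirichletCharacter ℂ N) (hχ : χ.Even) : ∑ a, χ a * G a = 0 :=
    (hχ.to_fun.mul_odd fun a ↦ by simp [G, hurwitzZetaOdd_neg]).sum_eq_zero
  have hterm (χ : DirichletCharacter ℂ N) :
      (if χ (-1) = -1 then ‖χ.LFunction 5‖ ^ 2 else 0)
        = ((N : ℝ) ^ 10)⁻¹ * ‖∑ a, χ a * G a‖ ^ 2 := by
    split_ifs with h
    · exact hodd χ h
    · simp [heven χ (χ.even_or_odd.resolve_right h)]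
  rw [sum_filter, sum_congr rfl fun χ _ ↦ hterm χ, ← mul_sum, sum_norm_sum_dirichletCharacter_sq,
    sum_filter, sum_filter, ← sum_univ_eq_sum_range_val]
  simp only [G, toAddCircle_apply]
  have hunit (a : ZMod N) : IsUnit a ↔ N.Coprime a.val := by
    rw [Nat.coprime_comm, ← ZMod.isUnit_iff_coprime, ZMod.natCast_zmod_val]
  simp only [hunit]
  ring

end

/-- Mean value of `|L(5,χ)|²` over Dirichlet characters mod `f` with `χ(-1) = (-1)`. -/
theorem mean_value_L_five_sq (f : ℕ) [NeZero f] (hf : 2 < f) :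
    (2 / (Nat.totient f : ℝ)) *
      ∑ χ ∈ Finset.univ.filter (fun χ : DirichletCharacter ℂ f => χ (-1) = (-1)),
        ‖χ.LFunction 5‖ ^ 2
    = (π ^ 10 / 93555) * ((∏ p ∈ f.primeFactors, (1 - 1 / (p : ℝ) ^ 10)) - 22 * (∏ p ∈ f.primeFactors, (1 - 1 / (p : ℝ) ^ 4)) / (f : ℝ) ^ 6 - 231 * (∏ p ∈ f.primeFactors, (1 - 1 / (p : ℝ) ^ 2)) / (f : ℝ) ^ 8) := by
  have hφ : (Nat.totient f : ℝ) ≠ 0 := by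
    exact_mod_cast (Nat.totient_pos.mpr (by lia : 0 < f)).ne'
  have hf0 : (f : ℝ) ≠ 0 := by exact_mod_cast (by lia : f ≠ 0)
  rw [sum_odd_norm_LFunction_five_sq, sum_coprime_norm_hurwitzZetaOdd_five_sq (by lia)]
  simp only [jordanTotient]
  field_simp
  ring
end

section
/- For every rational integer $m\ge 2$ we have the Bernoulli number identity $$(-1)^{m-1}\frac{B_{2m}}{m^2\binom{2m}{m}}+\sum_{k=0}^{\lfloor m/2\rfloor}\frac{B_{2k}B_{2(m-k)}}{m(m-k)}\binom{m}{2k}-\frac{1+(-1)^m}{2}\cdot\frac{B_m^2}{m^2}=0,$$ i.e. the polynomial $R_m(X)$ of the preceding lemma vanishes at $X=1$. -/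
open Polynomial in
/-- A polynomial over a field of characteristic zero that is invariant under the shift
`x ↦ 1 + x` is constant. -/
theorem eval_eq_eval_zero_of_eval_one_add {K : Type*} [Field K] [CharZero K] (p : K[X])
    (h : ∀ x, p.eval (1 + x) = p.eval x) (x : K) : p.eval x = p.eval 0 := by
  have hnat : ∀ n : ℕ, p.eval (n : K) = p.eval 0 := by
    intro n
    induction n with
    | zero => simp
    | succ n ih => rw [Nat.cast_succ, add_comm, h, ih]
  have hp : p = C (p.eval 0) := by
    refine eq_of_infinite_eval_eq _ _ ((Set.infinite_range_of_injective
      (Nat.cast_injective (R := K))).mono ?_)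
    rintro _ ⟨n, rfl⟩
    simp [hnat n]
  rw [hp]
  simp

/-- If `f` vanishes at the odd integers greater than `1`, its sum splits into the even-indexed
terms and the term of index `1`. -/
theorem sum_range_eq_sum_even_add {M : Type*} [AddCommMonoid M] (f : ℕ → M)
    (hf : ∀ j, Odd j → 1 < j → f j = 0) {m : ℕ} (hm : 1 ≤ m) :
    ∑ j ∈ Finset.range (m + 1), f j = (∑ k ∈ Finset.range (m / 2 + 1), f (2 * k)) + f 1 := by
  have key : ∀ q : ℕ, ∑ j ∈ Finset.range (2 * q + 2), f j
      = (∑ k ∈ Finset.range (q + 1), f (2 * k)) + f 1 := by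
    intro q
    induction q with
    | zero => simp [Finset.sum_range_succ]
    | succ q ih =>
      rw [show 2 * (q + 1) + 2 = 2 * q + 2 + 1 + 1 by ring, Finset.sum_range_succ,
        Finset.sum_range_succ, ih, Finset.sum_range_succ _ (q + 1),
        hf (2 * q + 2 + 1) ⟨q + 1, by ring⟩ (by lia), add_zero, add_right_comm]
      rfl
  obtain ⟨q, rfl | rfl⟩ := Nat.even_or_odd' m
  · rw [show 2 * q / 2 = q by lia, ← key q, Finset.sum_range_succ _ (2 * q + 1),
      hf (2 * q + 1) ⟨q, rfl⟩ (by lia), add_zero]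
  · rw [show (2 * q + 1) / 2 = q by lia, ← key q]

theorem integral_bernoulliFun_mul_succ (m n : ℕ) :
    ((m + 1 : ℕ) : ℝ) * (∫ x in (0 : ℝ)..1, bernoulliFun m x * bernoulliFun (n + 1) x)
      + ((n + 1 : ℕ) : ℝ) * (∫ x in (0 : ℝ)..1, bernoulliFun (m + 1) x * bernoulliFun n x)
      = bernoulliFun (m + 1) 1 * bernoulliFun (n + 1) 1
        - bernoulliFun (m + 1) 0 * bernoulliFun (n + 1) 0 := by
  rw [← intervalIntegral.integral_deriv_mul_eq_sub
    (fun x _ => hasDerivAt_bernoulliFun (m + 1) x) (fun x _ => hasDerivAt_bernoulliFun (n + 1) x)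
    (Continuous.intervalIntegrable (by fun_prop) _ _)
    (Continuous.intervalIntegrable (by fun_prop) _ _),
    intervalIntegral.integral_add (Continuous.intervalIntegrable (by fun_prop) _ _)
    (Continuous.intervalIntegrable (by fun_prop) _ _),
    ← intervalIntegral.integral_const_mul, ← intervalIntegral.integral_const_mul]
  simp only [Nat.add_sub_cancel]
  congr 2 <;> ext x <;> ring

open Nat in
/-- The integral over `[0, 1]` of a product of two non-constant Bernoulli polynomials. -/
theorem integral_bernoulliFun_mul_bernoulliFun (m n : ℕ) :
    ((m + n + 2)! : ℝ) * (∫ x in (0 : ℝ)..1, bernoulliFun (m + 1) x * bernoulliFun (n + 1) x)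
      = (-1) ^ m * (m + 1)! * (n + 1)! * bernoulli (m + n + 2) := by
  induction m generalizing n with
  | zero =>
    have h := integral_bernoulliFun_mul_succ 0 (n + 1)
    have h0 : ∫ x in (0 : ℝ)..1, bernoulliFun 0 x * bernoulliFun (n + 1 + 1) x = 0 := by
      simpa using integral_bernoulliFun_eq_zero (show n + 2 ≠ 0 by lia)
    rw [h0, bernoulliFun_eval_one (n + 1 + 1), bernoulliFun_eval_zero (n + 1 + 1)] at h
    norm_num at h
    simp only [zero_add, pow_zero, Nat.factorial_succ (n + 1), Nat.factorial_one]
    push_cast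
    simp only [bernoulliFun_one]
    linear_combination ((n + 1)! : ℝ) * h
  | succ m ih =>
    have h := integral_bernoulliFun_mul_succ (m + 1) (n + 1)
    rw [bernoulliFun_endpoints_eq_of_ne_one (by lia : m + 1 + 1 ≠ 1),
      bernoulliFun_endpoints_eq_of_ne_one (by lia : n + 1 + 1 ≠ 1), sub_self] at h
    have ih' := ih (n + 1)
    rw [show m + (n + 1) + 2 = m + 1 + n + 2 by ring] at ih'
    have hn : ((n + 1 + 1 : ℕ) : ℝ) ≠ 0 := by positivity
    apply mul_left_cancel₀ hn
    rw [Nat.factorial_succ (n + 1)] at ih'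
    rw [Nat.factorial_succ (m + 1)]
    push_cast at ih' h ⊢
    linear_combination ((m + 1 + n + 2)! : ℝ) * h - ((m : ℝ) + 1 + 1) * ih'

open Polynomial in
theorem eval_bernoulli_mul_pow (m : ℕ) (hm : 1 ≤ m) (x : ℚ) :
    (Polynomial.bernoulli m).eval x * x ^ (m - 1)
      = (∑ k ∈ Finset.range (m / 2 + 1),
          _root_.bernoulli (2 * k) * m.choose (2 * k) * x ^ (2 * (m - k) - 1))
        - m / 2 * x ^ (2 * m - 2) := by
  rw [Polynomial.bernoulli, eval_finsetSum, Finset.sum_mul, sum_range_eq_sum_even_add _ _ hm]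
  · have h1 : x ^ (m - 1) * x ^ (m - 1) = x ^ (2 * m - 2) := by
      rw [← pow_add]; congr 1; lia
    rw [sub_eq_add_neg]
    congr 1
    · refine Finset.sum_congr rfl fun k hk => ?_
      rw [Finset.mem_range] at hk
      rw [eval_monomial, mul_assoc, ← pow_add]
      congr 2
      lia
    · rw [eval_monomial, mul_assoc, h1, _root_.bernoulli_one, Nat.choose_one_right]
      ring
  · intro j hj hj1
    simp [bernoulli_eq_zero_of_odd hj hj1]

/-- The part of the expansion of `B_m²` in Bernoulli polynomials of positive degree. -/
noncomputable def bernoulliSqExpansion (m : ℕ) : Polynomial ℚ :=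
  ∑ k ∈ Finset.range (m / 2 + 1),
    Polynomial.C (m * m.choose (2 * k) * bernoulli (2 * k) / ((m - k : ℕ) : ℚ))
      * Polynomial.bernoulli (2 * (m - k))

open Polynomial in
theorem eval_one_add_bernoulliSqExpansion (m : ℕ) (hm : 1 ≤ m) (x : ℚ) :
    (Polynomial.bernoulli m ^ 2 - bernoulliSqExpansion m).eval (1 + x)
      = (Polynomial.bernoulli m ^ 2 - bernoulliSqExpansion m).eval x := by
  have hS : (bernoulliSqExpansion m).eval (1 + x) = (bernoulliSqExpansion m).eval x
      + 2 * m * ∑ k ∈ Finset.range (m / 2 + 1),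
          _root_.bernoulli (2 * k) * m.choose (2 * k) * x ^ (2 * (m - k) - 1) := by
    rw [bernoulliSqExpansion, eval_finsetSum, eval_finsetSum, Finset.mul_sum,
      ← Finset.sum_add_distrib]
    refine Finset.sum_congr rfl fun k hk => ?_
    rw [Finset.mem_range] at hk
    have hk0 : ((m - k : ℕ) : ℚ) ≠ 0 := by
      rw [Nat.cast_ne_zero]; lia
    rw [eval_C_mul, eval_C_mul, bernoulli_eval_one_add, Nat.cast_mul]
    field_simp
    push_cast
    ring
  have h1 : x ^ (m - 1) * x ^ (m - 1) = x ^ (2 * m - 2) := by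
    rw [← pow_add]; congr 1; lia
  rw [eval_sub, eval_sub, eval_pow, eval_pow, hS, bernoulli_eval_one_add]
  linear_combination 2 * (m : ℚ) * eval_bernoulli_mul_pow m hm x + (m : ℚ) ^ 2 * h1

open Nat in
/-- The expansion of `B_m(0)²` in Bernoulli numbers, the constant term being `∫₀¹ B_m²`. -/
theorem bernoulli_sq_eq (m : ℕ) (hm : 1 ≤ m) :
    bernoulli m ^ 2 = (∑ k ∈ Finset.range (m / 2 + 1),
        m * m.choose (2 * k) * bernoulli (2 * k) / ((m - k : ℕ) : ℚ) * bernoulli (2 * (m - k)))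
      + (-1) ^ (m - 1) * bernoulli (2 * m) / (2 * m).choose m := by
  set p := Polynomial.bernoulli m ^ 2 - bernoulliSqExpansion m with hp
  have hpC : p = Polynomial.C (p.eval 0) := Polynomial.funext fun x => by
    rw [Polynomial.eval_C]
    exact eval_eq_eval_zero_of_eval_one_add p (eval_one_add_bernoulliSqExpansion m hm) x
  have hreal : ∀ x : ℝ, bernoulliFun m x * bernoulliFun m x
      = (∑ k ∈ Finset.range (m / 2 + 1),
        ((m * m.choose (2 * k) * bernoulli (2 * k) / ((m - k : ℕ) : ℚ) : ℚ) : ℝ)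
          * bernoulliFun (2 * (m - k)) x) + ((p.eval 0 : ℚ) : ℝ) := by
    intro x
    have h : Polynomial.bernoulli m ^ 2 = bernoulliSqExpansion m + Polynomial.C (p.eval 0) := by
      rw [← hpC, hp]; ring
    have h' := congrArg (fun q => (q.map (algebraMap ℚ ℝ)).eval x) h
    simpa [bernoulliSqExpansion, Polynomial.eval_finsetSum, Polynomial.map_sum, sq,
      bernoulliFun] using h'
  have hint : ∫ x in (0 : ℝ)..1, bernoulliFun m x * bernoulliFun m x = ((p.eval 0 : ℚ) : ℝ) := by
    simp only [hreal]
    rw [intervalIntegral.integral_add (Continuous.intervalIntegrable (by fun_prop) _ _)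
      (Continuous.intervalIntegrable (by fun_prop) _ _), intervalIntegral.integral_finsetSum
      fun k _ => Continuous.intervalIntegrable (by fun_prop) _ _, Finset.sum_eq_zero]
    · simp
    · intro k hk
      rw [Finset.mem_range] at hk
      rw [intervalIntegral.integral_const_mul, integral_bernoulliFun_eq_zero (by lia), mul_zero]
  obtain ⟨n, rfl⟩ : ∃ n, m = n + 1 := ⟨m - 1, by lia⟩
  have hJ := integral_bernoulliFun_mul_bernoulliFun n n
  rw [hint, show n + n + 2 = 2 * (n + 1) by ring] at hJ
  have hfact : ((2 * (n + 1)).choose (n + 1) : ℚ) * (n + 1)! * (n + 1)! = (2 * (n + 1))! := by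
    have := Nat.choose_mul_factorial_mul_factorial (show n + 1 ≤ 2 * (n + 1) by lia)
    rw [show 2 * (n + 1) - (n + 1) = n + 1 by lia] at this
    exact_mod_cast this
  have hJ' : ((2 * (n + 1))! : ℚ) * p.eval 0
      = (-1) ^ n * (n + 1)! * (n + 1)! * bernoulli (2 * (n + 1)) := by exact_mod_cast hJ
  have hc : p.eval 0
      = (-1) ^ n * bernoulli (2 * (n + 1)) / (2 * (n + 1)).choose (n + 1) := by
    have hch : ((2 * (n + 1)).choose (n + 1) : ℚ) ≠ 0 :=
      Nat.cast_ne_zero.2 (Nat.choose_pos (by lia)).ne'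
    have hf : ((n + 1)! : ℚ) ≠ 0 := Nat.cast_ne_zero.2 (Nat.factorial_ne_zero _)
    rw [eq_div_iff hch]
    apply mul_left_cancel₀ (mul_ne_zero hf hf)
    linear_combination hJ' + p.eval 0 * hfact
  rw [Nat.add_sub_cancel, ← hc, hp]
  simp [bernoulliSqExpansion, Polynomial.eval_finsetSum]


/-- **A Bernoulli number identity:** for every integer `m ≥ 2`,
`(-1)^{m-1} B_{2m}/(m² C(2m,m))
  + ∑_{k=0}^{⌊m/2⌋} (B_{2k} B_{2(m-k)}/(m(m-k))) C(m,2k)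
  - ((1+(-1)^m)/2) B_m²/m² = 0`. -/
theorem bernoulli_identity (m : ℕ) (hm : 2 ≤ m) :
    (-1 : ℚ) ^ (m - 1) * bernoulli (2 * m) /
        ((m : ℚ) ^ 2 * (Nat.choose (2 * m) m : ℚ))
      + (∑ k ∈ Finset.range (m / 2 + 1),
          (bernoulli (2 * k) : ℚ) * bernoulli (2 * (m - k)) /
              ((m : ℚ) * ((m - k : ℕ) : ℚ)) * (Nat.choose m (2 * k) : ℚ))
      - (1 + (-1 : ℚ) ^ m) / 2 * (bernoulli m : ℚ) ^ 2 / (m : ℚ) ^ 2 = 0 := by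
  have hm0 : (m : ℚ) ≠ 0 := by
    rw [Nat.cast_ne_zero]; lia
  have hB : (1 + (-1 : ℚ) ^ m) / 2 * (bernoulli m : ℚ) ^ 2 = bernoulli m ^ 2 := by
    rcases Nat.even_or_odd m with h | h
    · rw [h.neg_one_pow]; ring
    · rw [bernoulli_eq_zero_of_odd h (by lia)]; ring
  have hS : ∑ k ∈ Finset.range (m / 2 + 1),
        (bernoulli (2 * k) : ℚ) * bernoulli (2 * (m - k)) /
          ((m : ℚ) * ((m - k : ℕ) : ℚ)) * (Nat.choose m (2 * k) : ℚ)
      = (∑ k ∈ Finset.range (m / 2 + 1), m * m.choose (2 * k) * bernoulli (2 * k)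
          / ((m - k : ℕ) : ℚ) * bernoulli (2 * (m - k))) / (m : ℚ) ^ 2 := by
    rw [Finset.sum_div]
    refine Finset.sum_congr rfl fun k hk => ?_
    field_simp
  rw [hB, hS, bernoulli_sq_eq m (by lia), mul_comm ((m : ℚ) ^ 2), ← div_div]
  ring
end

section
/- Let $f>2$ and $m\ge 1$ be rational integers and let $\chi$ be a Dirichlet character modulo $f$ with $\chi(-1)=(-1)^m$ and $(m,\chi)\ne(1,\chi_0)$. Then $$L(m,\chi)=\frac{(-1)^{m-1}\pi^m}{2\cdot f^m\cdot (m-1)!}\sum_{k=1}^{f-1}\chi(k)\,\cot^{(m-1)}(\pi k/f).$$ -/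
open scoped Real
open Filter Topology

/-- The sum of the terms of `∑ 1 / (x + j) ^ k` (over integers `j`) with index `n` and `-n - 1`. -/
noncomputable def poleTerm (k n : ℕ) (x : ℝ) : ℝ := 1 / (x + n) ^ k + 1 / (x - n - 1) ^ k

lemma summable_one_div_nat_add_pow {ε : ℝ} (hε : 0 < ε) {k : ℕ} (hk : 2 ≤ k) :
    Summable fun n : ℕ ↦ 1 / ((n : ℝ) + ε) ^ k := by
  have h := (Real.summable_one_div_nat_add_rpow ε k).2 (by exact_mod_cast hk)
  refine h.congr fun n ↦ ?_
  rw [abs_of_pos (by positivity), Real.rpow_natCast]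

lemma abs_poleTerm_le {ε x : ℝ} (hε : 0 < ε) (h₀ : ε ≤ x) (h₁ : x ≤ 1 - ε) (k n : ℕ) :
    |poleTerm k n x| ≤ 2 * (1 / ((n : ℝ) + ε) ^ k) := by
  have hn : (0 : ℝ) ≤ n := n.cast_nonneg
  rw [poleTerm, two_mul]
  refine (abs_add_le _ _).trans (add_le_add ?_ ?_)
  · rw [abs_div, abs_one, abs_pow, abs_of_pos (by linarith)]
    exact one_div_le_one_div_of_le (by positivity)
      (pow_le_pow_left₀ (by positivity) (by linarith) k)
  · rw [abs_div, abs_one, abs_pow, abs_of_neg (by linarith)]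
    exact one_div_le_one_div_of_le (by positivity)
      (pow_le_pow_left₀ (by positivity) (by linarith) k)

lemma summable_poleTerm {x : ℝ} (hx : x ∈ Set.Ioo (0 : ℝ) 1) {k : ℕ} (hk : 1 ≤ k) :
    Summable fun n ↦ poleTerm k n x := by
  obtain ⟨h₀, h₁⟩ := hx
  have hε : 0 < min x (1 - x) := lt_min h₀ (by linarith)
  have hx₀ : min x (1 - x) ≤ x := min_le_left _ _
  have hx₁ : min x (1 - x) ≤ 1 - x := min_le_right _ _
  generalize min x (1 - x) = ε at *
  rcases hk.eq_or_lt with rfl | hk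
  · refine .of_norm_bounded (summable_one_div_nat_add_pow hε le_rfl) fun n ↦ ?_
    have hn : (0 : ℝ) ≤ n := n.cast_nonneg
    have e : poleTerm 1 n x = (1 - 2 * x) / ((x + n) * (n + 1 - x)) := by
      have : x + n ≠ 0 := by linarith
      have : x - n - 1 ≠ 0 := by linarith
      have : n + 1 - x ≠ 0 := by linarith
      rw [poleTerm]
      field_simp
      ring
    rw [e, Real.norm_eq_abs, abs_div, abs_of_pos (a := (x + n) * _) (by
      apply mul_pos <;> linarith), sq]
    exact div_le_div₀ zero_le_one (abs_le.2 ⟨by linarith, by linarith⟩) (by positivity)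
      (mul_le_mul (by linarith) (by linarith) (by positivity) (by linarith))
  · exact .of_norm_bounded ((summable_one_div_nat_add_pow hε hk).mul_left 2) fun n ↦
      abs_poleTerm_le hε hx₀ (by linarith) k n

lemma hasDerivAt_poleTerm {x : ℝ} (hx : x ∈ Set.Ioo (0 : ℝ) 1) (k n : ℕ) :
    HasDerivAt (poleTerm k n) (-k * poleTerm (k + 1) n x) x := by
  obtain ⟨h₀, h₁⟩ := hx
  have hn : (0 : ℝ) ≤ n := n.cast_nonneg
  have a₀ : x + n ≠ 0 := by linarith
  have a₁ : x - n - 1 ≠ 0 := by linarith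
  have d₀ := (((hasDerivAt_id x).add_const (n : ℝ)).pow k).inv (pow_ne_zero _ a₀)
  have d₁ := ((((hasDerivAt_id x).sub_const (n : ℝ)).sub_const 1).pow k).inv (pow_ne_zero _ a₁)
  refine ((d₀.add d₁).congr_deriv ?_).congr_of_eventuallyEq (.of_forall fun y ↦ ?_)
  · rcases k with _ | k
    · simp
    · simp only [poleTerm, id, Nat.add_sub_cancel, Pi.pow_apply]
      push_cast
      field_simp
      ring
  · simp [poleTerm]

lemma hasDerivAt_tsum_poleTerm {x : ℝ} (hx : x ∈ Set.Ioo (0 : ℝ) 1) {k : ℕ} (hk : 1 ≤ k) :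
    HasDerivAt (fun y ↦ ∑' n, poleTerm k n y) (-k * ∑' n, poleTerm (k + 1) n x) x := by
  obtain ⟨ε, hε, hε'⟩ := exists_between (lt_min hx.1 (sub_pos.2 hx.2))
  obtain ⟨hx₀, hx₁⟩ := lt_min_iff.1 hε'
  have hx' : x ∈ Set.Ioo ε (1 - ε) := ⟨hx₀, by linarith⟩
  rw [← tsum_mul_left]
  refine hasDerivAt_tsum_of_isPreconnected (g := fun n y ↦ poleTerm k n y)
    (g' := fun n y ↦ -k * poleTerm (k + 1) n y) (t := Set.Ioo ε (1 - ε)) (y₀ := x)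
    (((summable_one_div_nat_add_pow hε (Nat.succ_le_succ hk)).mul_left 2).mul_left (k : ℝ))
    isOpen_Ioo isPreconnected_Ioo (fun n y hy ↦ ?_) (fun n y hy ↦ ?_) hx'
    (summable_poleTerm hx hk) hx'
  · exact hasDerivAt_poleTerm ⟨by linarith [hy.1], by linarith [hy.2]⟩ k n
  · rw [norm_mul, norm_neg, Real.norm_natCast]
    gcongr
    exact abs_poleTerm_le hε hy.1.le hy.2.le (k + 1) n

lemma tsum_poleTerm_one {x : ℝ} (hx : x ∈ Set.Ioo (0 : ℝ) 1) :
    ∑' n, poleTerm 1 n x = π * Real.cot (π * x) := by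
  have hxc : (x : ℂ) ∈ Complex.integerComplement := by
    rw [Complex.mem_integerComplement_iff]
    rintro ⟨j, hj⟩
    have hj : (j : ℝ) = x := by exact_mod_cast hj
    obtain ⟨h₀, h₁⟩ := hj ▸ hx
    norm_cast at h₀ h₁
    omega
  have h : HasSum (fun n : ℕ ↦ 1 / (x - (n + 1)) + 1 / (x + (n + 1)))
      (π * Real.cot (π * x) - 1 / x) := by
    rw [← Complex.hasSum_ofReal]
    push_cast
    rw [cot_series_rep' hxc]
    exact (summable_cotTerm hxc).hasSum
  have h1 := h.tendsto_sum_nat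
  have h2 : Tendsto (fun N : ℕ ↦ 1 / (x + N)) atTop (𝓝 0) := by
    simp only [one_div]
    exact tendsto_inv_atTop_zero.comp (tendsto_atTop_add_const_left _ _ tendsto_natCast_atTop_atTop)
  have h3 := (h1.const_add (1 / x)).sub h2
  rw [add_sub_cancel, sub_zero] at h3
  refine tendsto_nhds_unique (summable_poleTerm hx le_rfl).hasSum.tendsto_sum_nat
    (h3.congr fun N ↦ ?_)
  induction N with
  | zero => simp
  | succ N ih =>
    rw [Finset.sum_range_succ, Finset.sum_range_succ, ← ih, poleTerm]
    push_cast
    ring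

lemma iteratedDeriv_cot_eq_tsum (k : ℕ) : ∀ y ∈ Set.Ioo 0 π,
    iteratedDeriv k Real.cot y =
      (-1) ^ k * k.factorial / π ^ (k + 1) * ∑' n, poleTerm (k + 1) n (y / π) := by
  have mem {y : ℝ} (hy : y ∈ Set.Ioo 0 π) : y / π ∈ Set.Ioo (0 : ℝ) 1 :=
    ⟨div_pos hy.1 Real.pi_pos, (div_lt_one Real.pi_pos).2 hy.2⟩
  induction k with
  | zero =>
    intro y hy
    rw [zero_add, tsum_poleTerm_one (mem hy), mul_div_cancel₀ _ Real.pi_ne_zero]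
    simp [Real.pi_ne_zero]
  | succ k ih =>
    intro y hy
    have h : iteratedDeriv k Real.cot =ᶠ[𝓝 y] _ :=
      eventually_of_mem (isOpen_Ioo.mem_nhds hy) ih
    rw [iteratedDeriv_succ, h.deriv_eq]
    have hd := ((hasDerivAt_tsum_poleTerm (mem hy) (Nat.succ_pos k)).comp y
      ((hasDerivAt_id y).div_const π)).const_mul ((-1) ^ k * k.factorial / π ^ (k + 1))
    refine hd.deriv.trans ?_
    have := Real.pi_ne_zero
    rw [Nat.factorial_succ]
    push_cast
    field_simp
    ring

open HurwitzZeta Complex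

lemma abs_one_div_rpow_sub_le {x y z s : ℝ} (hz : 0 < z) (hx : z ≤ x) (hy : z ≤ y)
    (hxy : |x - y| ≤ 1) (h1 : 1 ≤ s) (h2 : s ≤ 2) :
    |1 / x ^ s - 1 / y ^ s| ≤ 2 * (1 / z ^ 2 + 1 / z ^ 3) := by
  wlog h : x ≤ y generalizing x y
  · rw [abs_sub_comm]
    exact this hy hx (by rwa [abs_sub_comm]) (le_of_not_ge h)
  replace hxy : y ≤ x + 1 := by linarith [neg_abs_le (x - y)]
  have hx₀ : 0 < x := hz.trans_le hx
  have hy₀ : 0 < y := hx₀.trans_le h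
  have e : 1 / x ^ s - 1 / y ^ s = 1 / x ^ s * (1 - (x / y) ^ s) := by
    rw [Real.div_rpow hx₀.le hy₀.le]
    have : x ^ s ≠ 0 := by positivity
    field_simp
  have hq : x / y ≤ 1 := (div_le_one hy₀).2 h
  have hb := one_add_mul_self_le_rpow_one_add (s := x / y - 1)
    (by linarith [div_pos hx₀ hy₀]) h1
  rw [add_sub_cancel] at hb
  have hy' : 1 - x / y ≤ 1 / y := by
    rw [one_sub_div hy₀.ne']
    gcongr
    linarith
  have hp : 1 / x ^ s ≤ 1 / x + 1 / x ^ 2 := by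
    rcases le_total 1 x with h | h
    · have : 1 / x ^ s ≤ 1 / x := by
        gcongr
        exact Real.self_le_rpow_of_one_le h h1
      linarith [show 0 ≤ 1 / x ^ 2 by positivity]
    · have : 1 / x ^ s ≤ 1 / x ^ 2 := by
        gcongr
        rw [← Real.rpow_two]
        exact Real.rpow_le_rpow_of_exponent_ge hx₀ h h2
      linarith [show 0 ≤ 1 / x by positivity]
  have hc : 1 - (x / y) ^ s ≤ 2 * (1 / y) := by nlinarith
  have hc0 : 0 ≤ 1 - (x / y) ^ s :=
    sub_nonneg.2 (Real.rpow_le_one (by positivity) hq (by linarith))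
  rw [e, abs_of_nonneg (by positivity)]
  calc _ ≤ (1 / x + 1 / x ^ 2) * (2 * (1 / y)) := by gcongr
    _ ≤ (1 / z + 1 / z ^ 2) * (2 * (1 / z)) := by gcongr
    _ = _ := by
      field_simp

lemma two_mul_hurwitzZetaEven_natCast {x : ℝ} (hx : x ∈ Set.Ioo (0 : ℝ) 1) {m : ℕ} (hm : 2 ≤ m)
    (he : Even m) :
    2 * hurwitzZetaEven (x : UnitAddCircle) m = ((∑' n, poleTerm m n x : ℝ) : ℂ) := by
  have h := (hasSum_nat_hurwitzZetaEven_of_mem_Icc (a := x) (Set.Ioo_subset_Icc_self hx)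
    (s := m) (by rw [natCast_re]; exact_mod_cast hm)).mul_left 2
  rw [← h.tsum_eq, ofReal_tsum]
  congr 1 with n
  rw [poleTerm, cpow_natCast, cpow_natCast, ← he.neg_pow (x - n - 1 : ℝ)]
  push_cast
  ring

lemma hurwitzZetaOdd_ofReal_eq {x : ℝ} (hx : x ∈ Set.Ioo (0 : ℝ) 1) {s : ℝ} (hs : 1 < s) :
    2 * hurwitzZetaOdd (x : UnitAddCircle) s =
      ((∑' n : ℕ, (1 / (n + x) ^ s - 1 / (n + 1 - x) ^ s) : ℝ) : ℂ) := by
  have h := (hasSum_nat_hurwitzZetaOdd_of_mem_Icc (a := x) (Set.Ioo_subset_Icc_self hx)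
    (s := s) (by rwa [ofReal_re])).mul_left 2
  rw [← h.tsum_eq, ofReal_tsum]
  congr 1 with n
  have hn : (0 : ℝ) ≤ n := n.cast_nonneg
  rw [ofReal_sub, ofReal_div, ofReal_div, ofReal_cpow (by linarith [hx.1]),
    ofReal_cpow (by linarith [hx.2])]
  push_cast
  ring

lemma tendsto_tsum_one_div_rpow_sub {x : ℝ} (hx : x ∈ Set.Ioo (0 : ℝ) 1) :
    Tendsto (fun s : ℝ ↦ ∑' n : ℕ, (1 / (n + x) ^ s - 1 / (n + 1 - x) ^ s)) (𝓝[>] 1)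
      (𝓝 (∑' n, poleTerm 1 n x)) := by
  obtain ⟨ε, hε, hε'⟩ := exists_between (lt_min hx.1 (sub_pos.2 hx.2))
  obtain ⟨hx₀, hx₁⟩ := lt_min_iff.1 hε'
  refine tendsto_tsum_of_dominated_convergence
    (((summable_one_div_nat_add_pow hε le_rfl).add
      (summable_one_div_nat_add_pow hε (Nat.le_succ 2))).mul_left 2) (fun n ↦ ?_) ?_
  · have hn : (0 : ℝ) ≤ n := n.cast_nonneg
    have h₀ : (n + x : ℝ) ≠ 0 := by linarith
    have h₁ : (n + 1 - x : ℝ) ≠ 0 := by linarith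
    have hc : ContinuousAt (fun s : ℝ ↦ 1 / ((n : ℝ) + x) ^ s - 1 / ((n : ℝ) + 1 - x) ^ s) 1 := by
      refine (continuousAt_const.div (Real.continuousAt_const_rpow h₀) ?_).sub
        (continuousAt_const.div (Real.continuousAt_const_rpow h₁) ?_) <;> simpa
    have he : poleTerm 1 n x = 1 / ((n : ℝ) + x) ^ (1 : ℝ) - 1 / ((n : ℝ) + 1 - x) ^ (1 : ℝ) := by
      rw [poleTerm, Real.rpow_one, Real.rpow_one, pow_one, pow_one, add_comm x,
        show x - n - 1 = -(n + 1 - x) by ring, div_neg, ← sub_eq_add_neg]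
    rw [he]
    exact hc.tendsto.mono_left nhdsWithin_le_nhds
  · filter_upwards [Ioo_mem_nhdsGT (show (1 : ℝ) < 2 by norm_num)] with s hs n
    have hn : (0 : ℝ) ≤ n := n.cast_nonneg
    exact abs_one_div_rpow_sub_le (by positivity) (by linarith) (by linarith)
      (abs_le.2 ⟨by linarith, by linarith⟩) hs.1.le hs.2.le

lemma two_mul_hurwitzZetaOdd_natCast {x : ℝ} (hx : x ∈ Set.Ioo (0 : ℝ) 1) {m : ℕ} (hm : Odd m) :
    2 * hurwitzZetaOdd (x : UnitAddCircle) m = ((∑' n, poleTerm m n x : ℝ) : ℂ) := by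
  rcases (Nat.one_le_iff_ne_zero.2 hm.pos.ne').eq_or_lt with rfl | h
  · have hc : Tendsto (fun s : ℝ ↦ 2 * hurwitzZetaOdd (x : UnitAddCircle) s) (𝓝[>] 1)
        (𝓝 (2 * hurwitzZetaOdd (x : UnitAddCircle) (1 : ℝ))) :=
      ((continuous_const.mul ((differentiable_hurwitzZetaOdd _).continuous.comp
        continuous_ofReal)).tendsto 1).mono_left nhdsWithin_le_nhds
    rw [Nat.cast_one, ← ofReal_one]
    refine tendsto_nhds_unique hc
      (((continuous_ofReal.tendsto _).comp (tendsto_tsum_one_div_rpow_sub hx)).congr' ?_)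
    filter_upwards [self_mem_nhdsWithin] with s hs
    exact (hurwitzZetaOdd_ofReal_eq hx hs).symm
  · rw [← ofReal_natCast, hurwitzZetaOdd_ofReal_eq hx (by exact_mod_cast h)]
    congr 2 with n
    rw [poleTerm, Real.rpow_natCast, Real.rpow_natCast, add_comm x,
      show x - n - 1 = -(n + 1 - x) by ring, hm.neg_pow, div_neg, ← sub_eq_add_neg]

lemma sum_zmod_eq_sum_Ico {f : ℕ} [NeZero f] (g : ZMod f → ℂ) (h₀ : g 0 = 0) :
    ∑ j, g j = ∑ k ∈ Finset.Ico 1 f, g k := by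
  have hr : ∑ j, g j = ∑ k ∈ Finset.range f, g k := by
    refine Finset.sum_bij (fun j _ ↦ j.val) (fun j _ ↦ Finset.mem_range.2 j.val_lt)
      (fun i _ j _ h ↦ ZMod.val_injective f h) (fun k hk ↦ ⟨k, Finset.mem_univ _, ?_⟩)
      (fun j _ ↦ by rw [ZMod.natCast_zmod_val])
    exact ZMod.val_cast_of_lt (Finset.mem_range.1 hk)
  rw [hr, Finset.range_eq_Ico, Finset.sum_eq_sum_Ico_succ_bot (NeZero.pos f), Nat.cast_zero, h₀,
    zero_add]

lemma LFunction_natCast_eq_sum_tsum_poleTerm {f m : ℕ} [NeZero f] (hf : 1 < f) (hm : 1 ≤ m)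
    (χ : DirichletCharacter ℂ f) (hχ : χ (-1) = (-1) ^ m) :
    χ.LFunction m = 1 / (2 * (f : ℂ) ^ m) *
      ∑ k ∈ Finset.Ico 1 f, χ k * ((∑' n, poleTerm m n (k / f) : ℝ) : ℂ) := by
  have : Fact (1 < f) := ⟨hf⟩
  have hf₀ : (0 : ℝ) < f := by exact_mod_cast NeZero.pos f
  have hχ₀ : χ 0 = 0 := χ.map_zero
  have mem {k : ℕ} (hk : k ∈ Finset.Ico 1 f) : (k / f : ℝ) ∈ Set.Ioo (0 : ℝ) 1 := by
    obtain ⟨h₁, h₂⟩ := Finset.mem_Ico.1 hk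
    exact ⟨div_pos (by exact_mod_cast h₁) hf₀, (div_lt_one hf₀).2 (by exact_mod_cast h₂)⟩
  have key (H : UnitAddCircle → ℂ → ℂ)
      (hL : χ.LFunction m = (f : ℂ) ^ (-(m : ℂ)) * ∑ j, χ j * H (ZMod.toAddCircle j) m)
      (hH : ∀ x ∈ Set.Ioo (0 : ℝ) 1, 2 * H (x : UnitAddCircle) m = ((∑' n, poleTerm m n x : ℝ) : ℂ)) :
      χ.LFunction m = 1 / (2 * (f : ℂ) ^ m) *
        ∑ k ∈ Finset.Ico 1 f, χ k * ((∑' n, poleTerm m n (k / f) : ℝ) : ℂ) := by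
    rw [hL, sum_zmod_eq_sum_Ico _ (by rw [hχ₀, zero_mul]), cpow_neg, cpow_natCast,
      Finset.mul_sum, Finset.mul_sum]
    refine Finset.sum_congr rfl fun k hk ↦ ?_
    rw [ZMod.toAddCircle_natCast, ← hH _ (mem hk)]
    have : (f : ℂ) ≠ 0 := NeZero.ne _
    field_simp
  rcases m.even_or_odd with he | ho
  · refine key hurwitzZetaEven (ZMod.LFunction_def_even (fun j ↦ ?_) m) fun x hx ↦
      two_mul_hurwitzZetaEven_natCast hx (by obtain ⟨r, rfl⟩ := he; omega) he
    rw [← neg_one_mul, map_mul, hχ, he.neg_one_pow, one_mul]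
  · refine key hurwitzZetaOdd (ZMod.LFunction_def_odd (fun j ↦ ?_) m) fun x hx ↦
      two_mul_hurwitzZetaOdd_natCast hx ho
    rw [← neg_one_mul, map_mul, hχ, ho.neg_one_pow, neg_one_mul]

/-- **Finite cotangent-sum formula for `L(m,χ)`.**
If `f > 2`, `m ≥ 1`, `χ` is a Dirichlet character mod `f` with `χ(-1) = (-1)^m`
and `(m,χ) ≠ (1,χ₀)`, then
`L(m,χ) = ((-1)^{m-1} π^m / (2 f^m (m-1)!)) ∑_{k=1}^{f-1} χ(k) cot^{(m-1)}(πk/f)`. -/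
theorem L_eq_cotangent_sum (f m : ℕ) [NeZero f] (hf : 2 < f) (hm : 1 ≤ m)
    (χ : DirichletCharacter ℂ f) (hχ : χ (-1) = (-1) ^ m)
    (h : ¬(m = 1 ∧ χ = 1)) :
    χ.LFunction m
      = ((-1) ^ (m - 1) * (π : ℂ) ^ m /
            (2 * (f : ℂ) ^ m * (Nat.factorial (m - 1) : ℂ))) *
          ∑ k ∈ Finset.Ico 1 f,
            χ (k : ZMod f) * Complex.ofReal (iteratedDeriv (m - 1) Real.cot (π * k / f)) := by
  obtain ⟨m, rfl⟩ := Nat.exists_eq_succ_of_ne_zero (Nat.one_le_iff_ne_zero.1 hm)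
  rw [LFunction_natCast_eq_sum_tsum_poleTerm (by omega) hm χ hχ, Finset.mul_sum, Finset.mul_sum]
  refine Finset.sum_congr rfl fun k hk ↦ ?_
  obtain ⟨h₁, h₂⟩ := Finset.mem_Ico.1 hk
  have hf₀ : (0 : ℝ) < f := by exact_mod_cast NeZero.pos f
  have hk₀ : (0 : ℝ) < k := by exact_mod_cast h₁
  have hkf : (k : ℝ) < f := by exact_mod_cast h₂
  have hy : π * k / f ∈ Set.Ioo 0 π :=
    ⟨by positivity, by rw [div_lt_iff₀ hf₀]; exact mul_lt_mul_of_pos_left hkf Real.pi_pos⟩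
  rw [Nat.succ_eq_add_one, Nat.add_sub_cancel, iteratedDeriv_cot_eq_tsum m _ hy,
    show π * k / f / π = k / f by field_simp]
  generalize ∑' n, poleTerm (m + 1) n (k / f) = S
  have h₃ : (π : ℂ) ≠ 0 := ofReal_ne_zero.2 Real.pi_ne_zero
  have h₄ : (f : ℂ) ≠ 0 := NeZero.ne _
  have h₅ : (m.factorial : ℂ) ≠ 0 := Nat.cast_ne_zero.2 m.factorial_ne_zero
  have h₆ : ((-1 : ℂ) ^ m) * (-1) ^ m = 1 := by rw [← mul_pow]; simp
  push_cast
  field_simp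
  linear_combination (-(χ k) * S) * h₆
end
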